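/- arXiv:1709.00032 — 10 statements merged into one kernel-verified Lean document; each statement's English description precedes it below -/
import Mathlib

section
/- Let X be a uniformly smooth Banach space and let X₁ be a one-complemented closed subspace of X. If X is a universal pointwise BPB domain space, then so is X₁. -/
open scoped Topology ENNReal
open Filter Metric

noncomputable section

/-- The pair `(X, Y)` has the pointwise Bishop–Phelps–Bollobás property. -/
def PtwiseBPB (𝕜 X Y : Type*) [RCLike 𝕜] [NormedAddCommGroup X] [NormedSpace 𝕜 X]
    [NormedAddCommGroup Y] [NormedSpace 𝕜 Y] : Prop :=
  ∀ ε : ℝ, 0 < ε → ∃ η : ℝ, 0 < η ∧ ∀ (T : X →L[𝕜] Y) (x₀ : X),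
    ‖T‖ = 1 → ‖x₀‖ = 1 → 1 - η < ‖T x₀‖ →
    ∃ S : X →L[𝕜] Y, ‖S‖ = 1 ∧ ‖S x₀‖ = 1 ∧ ‖S - T‖ < ε

/-- The modulus of the pointwise BPB property of the pair `(X, Y)`. -/
def bpbModulus (𝕜 X Y : Type*) [RCLike 𝕜] [NormedAddCommGroup X] [NormedSpace 𝕜 X]
    [NormedAddCommGroup Y] [NormedSpace 𝕜 Y] (ε : ℝ) : ℝ :=
  sSup (insert 0 {ρ : ℝ | 0 < ρ ∧ ∀ (T : X →L[𝕜] Y) (x₀ : X),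
    ‖T‖ = 1 → ‖x₀‖ = 1 → 1 - ρ < ‖T x₀‖ →
    ∃ S : X →L[𝕜] Y, ‖S‖ = 1 ∧ ‖S x₀‖ = 1 ∧ ‖S - T‖ < ε})

/-- The modulus of smoothness of a normed space. -/
def modulusOfSmoothness (X : Type*) [NormedAddCommGroup X] (t : ℝ) : ℝ :=
  sSup {r : ℝ | ∃ x y : X, ‖x‖ = 1 ∧ ‖y‖ ≤ t ∧ r = (‖x + y‖ + ‖x - y‖ - 2) / 2}

/-- A normed space is uniformly smooth if `ρ_X(t)/t → 0` as `t → 0⁺`. -/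
def UniformlySmooth (X : Type*) [NormedAddCommGroup X] : Prop :=
  Filter.Tendsto (fun t => modulusOfSmoothness X t / t) (𝓝[>] (0:ℝ)) (𝓝 0)

/-- The modulus of convexity of a normed space. -/
def modulusOfConvexity (X : Type*) [NormedAddCommGroup X] (ε : ℝ) : ℝ :=
  sInf {r : ℝ | ∃ x y : X, ‖x‖ ≤ 1 ∧ ‖y‖ ≤ 1 ∧ ε ≤ ‖x - y‖ ∧ r = 1 - ‖x + y‖ / 2}

/-- The pointwise BPB property of `(X, Y)` passes to one-complemented subspaces of `X`. -/
theorem PtwiseBPB.of_one_complemented {𝕜 X Y : Type*} [RCLike 𝕜]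
    [NormedAddCommGroup X] [NormedSpace 𝕜 X] [NormedAddCommGroup Y] [NormedSpace 𝕜 Y]
    (X₁ : Submodule 𝕜 X) (P : X →L[𝕜] X) (hPnorm : ‖P‖ ≤ 1) (hPmem : ∀ x : X, P x ∈ X₁)
    (hPfix : ∀ x ∈ X₁, P x = x) (h : PtwiseBPB 𝕜 X Y) : PtwiseBPB 𝕜 X₁ Y := by
  intro ε hε
  obtain ⟨η, hη, H⟩ := h ε hε
  refine ⟨η, hη, fun T x₀ hT hx₀ hTx₀ => ?_⟩
  set Q : X →L[𝕜] X₁ := P.codRestrict X₁ hPmem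
  have hQfix (x : X₁) : Q x = x := Subtype.ext (hPfix x x.2)
  have hQ (x : X) : ‖Q x‖ ≤ ‖x‖ :=
    (P.le_of_opNorm_le hPnorm x).trans_eq (one_mul _)
  have hTQ : ‖T.comp Q‖ = 1 := by
    apply le_antisymm
    · refine ContinuousLinearMap.opNorm_le_bound _ zero_le_one fun x => ?_
      simpa using (T.le_of_opNorm_le hT.le (Q x)).trans (by simpa using hQ x)
    · rw [← hT]
      refine ContinuousLinearMap.opNorm_le_bound _ (norm_nonneg _) fun x => ?_
      simpa [hQfix] using (T.comp Q).le_opNorm (x : X)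
  obtain ⟨S, hS, hSx₀, hST⟩ := H (T.comp Q) x₀ hTQ hx₀ (by simpa [hQfix] using hTx₀)
  refine ⟨S.comp X₁.subtypeL, ?_, hSx₀, lt_of_le_of_lt ?_ hST⟩
  · apply le_antisymm
    · refine ContinuousLinearMap.opNorm_le_bound _ zero_le_one fun x => ?_
      exact S.le_of_opNorm_le hS.le x
    · have := (S.comp X₁.subtypeL).le_opNorm x₀
      rw [hx₀, mul_one] at this
      exact hSx₀.symm.le.trans this
  · refine ContinuousLinearMap.opNorm_le_bound _ (norm_nonneg _) fun x => ?_
    simpa [hQfix] using (S - T.comp Q).le_opNorm (x : X)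

/-- A one-complemented closed subspace of a uniformly smooth universal
pointwise BPB domain space is again a universal pointwise BPB domain space. -/
theorem universal_domain_of_one_complemented {𝕜 : Type*} [RCLike 𝕜]
    {X : Type*} [NormedAddCommGroup X] [NormedSpace 𝕜 X] [CompleteSpace X]
    (hX : UniformlySmooth X)
    (X₁ : Submodule 𝕜 X) (hX₁ : IsClosed (X₁ : Set X))
    (P : X →L[𝕜] X) (hPnorm : ‖P‖ = 1) (hPmem : ∀ x : X, P x ∈ X₁)
    (hPfix : ∀ x ∈ X₁, P x = x)
    (h : ∀ (Y : Type) [NormedAddCommGroup Y] [NormedSpace 𝕜 Y] [CompleteSpace Y],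
      PtwiseBPB 𝕜 X Y) :
    ∀ (Y : Type) [NormedAddCommGroup Y] [NormedSpace 𝕜 Y] [CompleteSpace Y],
      PtwiseBPB 𝕜 X₁ Y := by
  intro Y _ _ _
  exact (h Y).of_one_complemented X₁ P hPnorm.le hPmem hPfix

end
end

section
/- Let X be a uniformly smooth Banach space, Y an arbitrary Banach space, 1 < p < ∞, and let μ be a positive measure admitting a measurable set A with 0 < μ(A) < ∞. If the pair (L_p(μ, X), Y) has the pointwise Bishop–Phelps–Bollobás property, then so does the pair (X, Y). -/
open scoped Topology ENNReal
open Filter Metric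

noncomputable section

/-- The pointwise BPB property of the domain passes to subspaces complemented by a contractive
projection. -/
theorem PtwiseBPB.of_contractive_retraction {𝕜 X Y Z : Type*} [RCLike 𝕜]
    [NormedAddCommGroup X] [NormedSpace 𝕜 X] [NormedAddCommGroup Y] [NormedSpace 𝕜 Y]
    [NormedAddCommGroup Z] [NormedSpace 𝕜 Z] (h : PtwiseBPB 𝕜 Z Y)
    (J : X →L[𝕜] Z) (P : Z →L[𝕜] X) (hJ : ‖J‖ ≤ 1) (hP : ‖P‖ ≤ 1) (hPJ : ∀ x, P (J x) = x) :
    PtwiseBPB 𝕜 X Y := by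
  intro ε hε
  obtain ⟨η, hη, H⟩ := h ε hε
  refine ⟨η, hη, fun T x₀ hT hx₀ hTx₀ => ?_⟩
  have hcomp : ∀ R : Z →L[𝕜] Y, ‖R.comp J‖ ≤ ‖R‖ := fun R =>
    (R.opNorm_comp_le J).trans (mul_le_of_le_one_right (norm_nonneg _) hJ)
  have hTPJ : (T.comp P).comp J = T := by
    ext x
    simp [hPJ]
  have hTP : ‖T.comp P‖ = 1 := by
    apply le_antisymm
    · calc ‖T.comp P‖ ≤ ‖T‖ * ‖P‖ := T.opNorm_comp_le P
        _ ≤ 1 := by rwa [hT, one_mul]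
    · rw [← hT, ← congrArg norm hTPJ]
      exact hcomp _
  have hJx₀ : ‖J x₀‖ = 1 := by
    apply le_antisymm
    · simpa [hx₀] using J.le_of_opNorm_le hJ x₀
    · simpa [hx₀, hPJ] using P.le_of_opNorm_le hP (J x₀)
  obtain ⟨S, hS, hSx₀, hST⟩ := H (T.comp P) (J x₀) hTP hJx₀ (by simpa [hPJ] using hTx₀)
  refine ⟨S.comp J, le_antisymm ((hcomp S).trans_eq hS) ?_, hSx₀, ?_⟩
  · simpa [hx₀, hSx₀] using (S.comp J).le_opNorm x₀
  · calc ‖S.comp J - T‖ = ‖(S - T.comp P).comp J‖ := by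
          rw [ContinuousLinearMap.sub_comp, hTPJ]
      _ ≤ ‖S - T.comp P‖ := hcomp _
      _ < ε := hST

section SetIntegral

open MeasureTheory

variable {α X : Type*} [MeasurableSpace α] {μ : Measure α} {p : ℝ≥0∞} [NormedAddCommGroup X]
  {A : Set α}

/-- Functions in `L_p` are integrable on sets of finite measure. -/
theorem MeasureTheory.Lp.integrableOn_of_measure_ne_top (hp : 1 ≤ p) (hA : μ A ≠ ∞)
    (f : Lp X p μ) : IntegrableOn f A μ := by
  have : IsFiniteMeasure (μ.restrict A) := ⟨by simpa using hA.lt_top⟩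
  exact ((Lp.memLp f).restrict A).integrable hp

/-- Hölder's inequality for the integral of an `L_p` function over a set of finite measure. -/
theorem MeasureTheory.Lp.norm_setIntegral_le [NormedSpace ℝ X] (hp : 1 ≤ p) (hA : μ A ≠ ∞)
    (f : Lp X p μ) :
    ‖∫ x in A, f x ∂μ‖ ≤ μ.real A ^ (1 - 1 / p.toReal) * ‖f‖ := by
  have hexp : 0 ≤ 1 - 1 / p.toReal := by
    rcases eq_or_ne p ∞ with rfl | hp'
    · simp
    · have : 1 ≤ p.toReal := by simpa using ENNReal.toReal_mono hp' hp
      rw [sub_nonneg]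
      exact div_le_one_of_le₀ this (by positivity)
  have hbound : ‖∫ x in A, f x ∂μ‖ₑ ≤ eLpNorm f p μ * μ A ^ (1 - 1 / p.toReal) :=
    calc ‖∫ x in A, f x ∂μ‖ₑ ≤ eLpNorm f 1 (μ.restrict A) := by
          rw [eLpNorm_one_eq_lintegral_enorm]
          exact enorm_integral_le_lintegral_enorm _
      _ ≤ eLpNorm f p (μ.restrict A) * μ A ^ (1 - 1 / p.toReal) := by
          simpa using eLpNorm_le_eLpNorm_mul_rpow_measure_univ (μ := μ.restrict A) hp
            (Lp.aestronglyMeasurable f).restrict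
      _ ≤ eLpNorm f p μ * μ A ^ (1 - 1 / p.toReal) := by
          gcongr
          exact Measure.restrict_le_self
  have hfin : eLpNorm f p μ * μ A ^ (1 - 1 / p.toReal) ≠ ∞ :=
    ENNReal.mul_ne_top (Lp.eLpNorm_ne_top f) (ENNReal.rpow_ne_top_of_nonneg hexp hA)
  have := ENNReal.toReal_mono hfin hbound
  rwa [toReal_enorm, ENNReal.toReal_mul, ← ENNReal.toReal_rpow, mul_comm, ← Lp.norm_def] at this

variable (𝕜 : Type*) [RCLike 𝕜] [NormedSpace 𝕜 X]

/-- Integration over a set of finite measure, as a continuous linear map on `L_p`. -/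
def MeasureTheory.Lp.setIntegralCLM [NormedSpace ℝ X] [SMulCommClass ℝ 𝕜 X] (p : ℝ≥0∞)
    [Fact (1 ≤ p)] (hA : μ A ≠ ∞) : Lp X p μ →L[𝕜] X :=
  LinearMap.mkContinuous
    { toFun := fun f => ∫ x in A, f x ∂μ
      map_add' := fun f g => by
        rw [integral_congr_ae (ae_restrict_of_ae (Lp.coeFn_add f g))]
        exact integral_add (Lp.integrableOn_of_measure_ne_top Fact.out hA f)
          (Lp.integrableOn_of_measure_ne_top Fact.out hA g)
      map_smul' := fun c f => by
        rw [integral_congr_ae (ae_restrict_of_ae (Lp.coeFn_smul c f))]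
        exact integral_smul c _ }
    (μ.real A ^ (1 - 1 / p.toReal)) (fun f => Lp.norm_setIntegral_le Fact.out hA f)

/-- The map sending `x` to the function equal to `x` on a set of finite measure and to `0`
elsewhere, as a continuous linear map into `L_p`. -/
def MeasureTheory.Lp.indicatorConstCLM (p : ℝ≥0∞) [Fact (1 ≤ p)] (hA : MeasurableSet A)
    (hA' : μ A ≠ ∞) : X →L[𝕜] Lp X p μ :=
  LinearMap.mkContinuous
    { toFun := fun x => indicatorConstLp p hA hA' x
      map_add' := fun _ _ => indicatorConstLp_add.symm
      map_smul' := fun c x => by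
        simp_rw [indicatorConstLp, Set.indicator_const_smul, RingHom.id_apply]
        rfl }
    (μ.real A ^ (1 / p.toReal)) (fun x =>
      (norm_indicatorConstLp_le (hs := hA) (hμs := hA') (c := x)).trans_eq (mul_comm _ _))

end SetIntegral

open MeasureTheory in
/-- If `X` is uniformly smooth, `1 < p < ∞`, `μ` admits a measurable set of
finite positive measure, and `(L_p(μ, X), Y)` has the pointwise BPB property, then so does
`(X, Y)`. -/
theorem pointwiseBPB_of_Lp {𝕜 : Type*} [RCLike 𝕜]
    {X Y : Type*} [NormedAddCommGroup X] [NormedSpace 𝕜 X] [CompleteSpace X]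
    [NormedAddCommGroup Y] [NormedSpace 𝕜 Y] [CompleteSpace Y]
    {α : Type*} [MeasurableSpace α] (μ : Measure α)
    (p : ℝ≥0∞) [Fact (1 ≤ p)] (hp : 1 < p) (hp' : p ≠ ∞)
    (A : Set α) (hA : MeasurableSet A) (hA0 : 0 < μ A) (hAtop : μ A < ∞)
    (hX : UniformlySmooth X)
    (h : PtwiseBPB 𝕜 (Lp X p μ) Y) :
    PtwiseBPB 𝕜 X Y := by
  let : NormedSpace ℝ X := NormedSpace.restrictScalars ℝ 𝕜 X
  have : IsScalarTower ℝ 𝕜 X := ⟨fun r c x => by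
    change (r • c) • x = (algebraMap ℝ 𝕜 r) • c • x
    rw [Algebra.smul_def, mul_smul]⟩
  have hm : 0 < μ.real A := ENNReal.toReal_pos hA0.ne' hAtop.ne
  set a : ℝ := μ.real A ^ (1 / p.toReal) with ha
  set b : ℝ := μ.real A ^ (1 - 1 / p.toReal) with hb
  have ha0 : 0 < a := Real.rpow_pos_of_pos hm _
  have hb0 : 0 < b := Real.rpow_pos_of_pos hm _
  have hab : a * b = μ.real A := by
    rw [ha, hb, ← Real.rpow_add hm, add_sub_cancel, Real.rpow_one]
  refine h.of_contractive_retraction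
    (((a⁻¹ : ℝ) : 𝕜) • Lp.indicatorConstCLM 𝕜 p hA hAtop.ne)
    (((b⁻¹ : ℝ) : 𝕜) • Lp.setIntegralCLM 𝕜 p hAtop.ne) ?_ ?_ fun x => ?_
  · rw [norm_smul, RCLike.norm_ofReal, abs_of_pos (inv_pos.2 ha0)]
    exact (inv_mul_le_one₀ ha0).2 (LinearMap.mkContinuous_norm_le _ ha0.le _)
  · rw [norm_smul, RCLike.norm_ofReal, abs_of_pos (inv_pos.2 hb0)]
    exact (inv_mul_le_one₀ hb0).2 (LinearMap.mkContinuous_norm_le _ hb0.le _)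
  · have hint : Lp.setIntegralCLM 𝕜 p hAtop.ne (Lp.indicatorConstCLM 𝕜 p hA hAtop.ne x) =
        ((μ.real A : ℝ) : 𝕜) • x := by
      have := setIntegral_indicatorConstLp (p := p) hA hA hAtop.ne x
      rw [Set.inter_self] at this
      rw [← algebraMap_smul 𝕜] at this
      exact this
    simp only [_root_.smul_apply, map_smul, hint, smul_smul]
    rw [← RCLike.ofReal_mul, ← RCLike.ofReal_mul, ← hab]
    field_simp
    simp

end
end

section
/- Let X be a uniformly smooth Banach space, let Y be an arbitrary Banach space, and let K be a nonempty compact Hausdorff topological space. If the pair (X, C(K, Y)) has the pointwise Bishop–Phelps–Bollobás property, then so does the pair (X, Y); moreover, η̃(X, Y)(ε) ≥ η̃(X, C(K, Y))(ε) for every ε ∈ (0, 1). -/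
open scoped Topology ENNReal
open Filter Metric

noncomputable section

/-- Every norm-one operator that is nearly norming at a unit vector, up to the defect `ρ`, is
within `ε` of a norm-one operator attaining its norm at that vector. -/
def BPBAt (𝕜 X Y : Type*) [RCLike 𝕜] [NormedAddCommGroup X] [NormedSpace 𝕜 X]
    [NormedAddCommGroup Y] [NormedSpace 𝕜 Y] (ε ρ : ℝ) : Prop :=
  ∀ (T : X →L[𝕜] Y) (x₀ : X), ‖T‖ = 1 → ‖x₀‖ = 1 → 1 - ρ < ‖T x₀‖ →
    ∃ S : X →L[𝕜] Y, ‖S‖ = 1 ∧ ‖S x₀‖ = 1 ∧ ‖S - T‖ < ε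

section

variable {𝕜 X Y : Type*} [RCLike 𝕜] [NormedAddCommGroup X] [NormedSpace 𝕜 X]
  [NormedAddCommGroup Y] [NormedSpace 𝕜 Y] {ε ρ : ℝ}

lemma ContinuousMap.exists_norm_apply_eq {K : Type*} [TopologicalSpace K] [CompactSpace K]
    [Nonempty K] (f : C(K, Y)) : ∃ t, ‖f t‖ = ‖f‖ := by
  obtain ⟨t, -, ht⟩ := isCompact_univ.exists_isMaxOn Set.univ_nonempty
    (f.continuous.norm.continuousOn (s := Set.univ))
  refine ⟨t, le_antisymm (f.norm_coe_le_norm t) ?_⟩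
  exact (ContinuousMap.norm_le f (norm_nonneg _)).2 fun s => ht (Set.mem_univ s)

/-- The property `BPBAt` passes from `C(K, Y)` to `Y`: compose with constant functions, then
evaluate at a point where the norm is attained. -/
lemma BPBAt.of_continuousMap {K : Type*} [TopologicalSpace K] [CompactSpace K] [Nonempty K]
    (h : BPBAt 𝕜 X C(K, Y) ε ρ) : BPBAt 𝕜 X Y ε ρ := by
  intro T x₀ hT hx₀ hTx
  have norm_const (y : Y) : ‖ContinuousMap.const K y‖ = ‖y‖ := by
    obtain ⟨t, ht⟩ := (ContinuousMap.const K y).exists_norm_apply_eq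
    exact ht.symm
  let T' : X →L[𝕜] C(K, Y) := LinearMap.mkContinuous
    { toFun := fun x => ContinuousMap.const K (T x)
      map_add' := fun x y => by ext; simp
      map_smul' := fun c x => by ext; simp } ‖T‖
    fun x => (norm_const (T x)).trans_le (T.le_opNorm x)
  have hT'_apply (x : X) : T' x = ContinuousMap.const K (T x) := rfl
  have hT'_norm (x : X) : ‖T' x‖ = ‖T x‖ := norm_const (T x)
  have hT' : ‖T'‖ = 1 := by
    rw [← hT]
    refine le_antisymm (T'.opNorm_le_bound (norm_nonneg _) fun x => ?_)
      (T.opNorm_le_bound (norm_nonneg _) fun x => ?_)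
    · exact (hT'_norm x).trans_le (T.le_opNorm x)
    · exact (hT'_norm x).symm.trans_le (T'.le_opNorm x)
  obtain ⟨S', hS', hS'x, hS'T⟩ := h T' x₀ hT' hx₀ (by rwa [hT'_norm])
  obtain ⟨t, ht⟩ := (S' x₀).exists_norm_apply_eq
  let S : X →L[𝕜] Y := (ContinuousMap.evalCLM 𝕜 t).comp S'
  have hS_apply (x : X) : S x = S' x t := rfl
  have hSx : ‖S x₀‖ = 1 := by rw [hS_apply, ht, hS'x]
  refine ⟨S, le_antisymm ?_ ?_, hSx, lt_of_le_of_lt ?_ hS'T⟩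
  · rw [← hS']
    exact S.opNorm_le_bound (norm_nonneg _) fun x =>
      ((S' x).norm_coe_le_norm t).trans (S'.le_opNorm x)
  · simpa [hSx, hx₀] using S.le_opNorm x₀
  · refine (S - T).opNorm_le_bound (norm_nonneg _) fun x => ?_
    exact (((S' - T') x).norm_coe_le_norm t).trans ((S' - T').le_opNorm x)

/-- If `BPBAt` holds for a defect larger than one and `Y` is nontrivial, then every operator
attains its norm at every unit vector, since `X` is then at most one-dimensional. -/
lemma BPBAt.norm_apply_eq_opNorm [Nontrivial Y] (h : BPBAt 𝕜 X Y ε ρ) (hε : ε ≤ 1)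
    (hρ : 1 < ρ) {Z : Type*} [NormedAddCommGroup Z] [NormedSpace 𝕜 Z] (T : X →L[𝕜] Z) {x₀ : X}
    (hx₀ : ‖x₀‖ = 1) : ‖T x₀‖ = ‖T‖ := by
  obtain ⟨f, hf, hfx⟩ := exists_dual_vector 𝕜 x₀ (norm_ne_zero_iff.1 (by simp [hx₀]))
  obtain ⟨y, hy⟩ := exists_ne (0 : Y)
  have hfy : ‖f.smulRight ((‖y‖⁻¹ : 𝕜) • y)‖ = 1 := by
    rw [ContinuousLinearMap.norm_smulRight_apply, hf, one_mul, norm_smul_inv_norm hy]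
  have ker_f (z : X) (hz : f z = 0) : z = 0 := by
    by_contra hz0
    obtain ⟨S, -, hSz, hS⟩ := h (f.smulRight ((‖y‖⁻¹ : 𝕜) • y)) ((‖z‖⁻¹ : 𝕜) • z) hfy
      (norm_smul_inv_norm hz0) (by simp [hz]; linarith)
    have := (S - f.smulRight ((‖y‖⁻¹ : 𝕜) • y)).le_opNorm ((‖z‖⁻¹ : 𝕜) • z)
    rw [norm_smul_inv_norm hz0, sub_apply, ContinuousLinearMap.smulRight_apply,
      map_smul f, hz, smul_zero, zero_smul, sub_zero, hSz] at this
    linarith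
  refine le_antisymm (by simpa [hx₀] using T.le_opNorm x₀)
    (T.opNorm_le_bound (norm_nonneg _) fun x => ?_)
  have hx : x = f x • x₀ := sub_eq_zero.1 (ker_f _ (by simp [hfx, hx₀]))
  calc ‖T x‖ = ‖f x‖ * ‖T x₀‖ := by rw [hx, map_smul, norm_smul, ← hx]
    _ ≤ ‖x‖ * ‖T x₀‖ := by
      gcongr
      simpa [hf] using f.le_opNorm x
    _ = ‖T x₀‖ * ‖x‖ := mul_comm _ _

/-- If `BPBAt` holds for `Y` with a defect larger than one, then it holds for `C(K, Y)` with
every defect. -/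
lemma BPBAt.continuousMap {K : Type*} [TopologicalSpace K] [CompactSpace K]
    (h : BPBAt 𝕜 X Y ε ρ) (hε₀ : 0 < ε) (hε : ε ≤ 1) (hρ : 1 < ρ) (r : ℝ) :
    BPBAt 𝕜 X C(K, Y) ε r := by
  intro T x₀ hT hx₀ _
  rcases subsingleton_or_nontrivial Y with hY | hY
  · have hT0 : T = 0 := by
      ext
      exact Subsingleton.elim _ _
    simp [hT0] at hT
  · exact ⟨T, hT, (h.norm_apply_eq_opNorm hε hρ T hx₀).trans hT, by simpa⟩

end

/-- If `X` is uniformly smooth, `K` is a nonempty compact Hausdorff space and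
`(X, C(K, Y))` has the pointwise BPB property, then so does `(X, Y)`, with
`η̃(X, Y)(ε) ≥ η̃(X, C(K,Y))(ε)` for `ε ∈ (0,1)`. -/
theorem pointwiseBPB_of_continuousMap {𝕜 : Type*} [RCLike 𝕜]
    {X Y : Type*} [NormedAddCommGroup X] [NormedSpace 𝕜 X] [CompleteSpace X]
    [NormedAddCommGroup Y] [NormedSpace 𝕜 Y] [CompleteSpace Y]
    (K : Type*) [TopologicalSpace K] [CompactSpace K] [T2Space K] [Nonempty K]
    (hX : UniformlySmooth X)
    (h : PtwiseBPB 𝕜 X C(K, Y)) :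
    PtwiseBPB 𝕜 X Y ∧
      ∀ ε ∈ Set.Ioo (0:ℝ) 1, bpbModulus 𝕜 X C(K, Y) ε ≤ bpbModulus 𝕜 X Y ε := by
  refine ⟨fun ε hε => ?_, fun ε hε => ?_⟩
  · obtain ⟨η, hη, hη'⟩ := h ε hε
    exact ⟨η, hη, BPBAt.of_continuousMap (K := K) hη'⟩
  change sSup (insert 0 {ρ | 0 < ρ ∧ BPBAt 𝕜 X C(K, Y) ε ρ}) ≤
    sSup (insert 0 {ρ | 0 < ρ ∧ BPBAt 𝕜 X Y ε ρ})
  by_cases hbdd : ∃ ρ > 1, BPBAt 𝕜 X Y ε ρ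
  · obtain ⟨ρ, hρ, hρ'⟩ := hbdd
    have hC := hρ'.continuousMap (K := K) hε.1 hε.2.le hρ
    exact (congrArg sSup (congrArg (insert 0) (Set.ext fun r =>
      and_congr_right fun _ => ⟨BPBAt.of_continuousMap, fun _ => hC r⟩))).le
  · push Not at hbdd
    refine csSup_le_csSup ⟨1, ?_⟩ (Set.insert_nonempty _ _)
      (Set.insert_subset_insert fun ρ hρ => ⟨hρ.1, hρ.2.of_continuousMap⟩)
    rintro r (rfl | hr)
    · exact zero_le_one
    · exact not_lt.1 fun hr1 => hbdd r hr1 hr.2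

end
end

section
/- Let X be a nonzero Banach space over 𝕂 (𝕂 = ℝ or ℂ) and suppose that the pair (X, 𝕂) has the pointwise Bishop–Phelps–Bollobás property with a function η̃ : (0,1) → (0,∞); that is, for every ε ∈ (0,1), whenever f ∈ X* with ‖f‖ = 1 and x₀ with ‖x₀‖ = 1 satisfy |f(x₀)| > 1 − η̃(ε), there exists g ∈ X* with ‖g‖ = 1, |g(x₀)| = 1 and ‖g − f‖ < ε. Then for every ε ∈ (0, 1) and every t with 0 < t ≤ 1 and t < η̃(ε)/2, the modulus of smoothness satisfies ρ_X(t)/t < 2ε + 4√(η̃(ε) + ε). -/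
open scoped Topology ENNReal
open Filter Metric

noncomputable section

/-- The normalisation of `z` is at most twice as far from a unit vector `x` as `z` is. -/
lemma norm_normalize_sub_le {𝕜 X : Type*} [RCLike 𝕜] [NormedAddCommGroup X] [NormedSpace 𝕜 X]
    {x z : X} (hx : ‖x‖ = 1) (hz : z ≠ 0) :
    ‖((‖z‖ : 𝕜)⁻¹ • z) - x‖ ≤ 2 * ‖z - x‖ := by
  have hz' : (‖z‖ : 𝕜) ≠ 0 := by simpa using hz
  set u : X := (‖z‖ : 𝕜)⁻¹ • z with hu
  have hun : ‖u‖ = 1 := norm_smul_inv_norm hz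
  have hzu : z = (‖z‖ : 𝕜) • u := by rw [hu, smul_inv_smul₀ hz']
  have huz : ‖u - z‖ ≤ ‖z - x‖ := by
    have : u - z = ((1 - ‖z‖ : ℝ) : 𝕜) • u := by
      conv_lhs => rw [hzu]
      push_cast
      rw [sub_smul, one_smul]
    rw [this, norm_smul, hun, mul_one, RCLike.norm_ofReal, ← hx, norm_sub_rev z x]
    exact abs_norm_sub_norm_le x z
  calc ‖u - x‖ ≤ ‖u - z‖ + ‖z - x‖ := norm_sub_le_norm_sub_add_norm_sub u z x
    _ ≤ 2 * ‖z - x‖ := by linarith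

/-- If a unit functional `φ` with `φ x = 1` is within `ε` of a unit functional that attains its
norm at the direction of `x + y`, then the norm at `x + y` is close to its linearisation by `φ`. -/
lemma norm_add_le_of_norm_attaining {𝕜 X : Type*} [RCLike 𝕜] [NormedAddCommGroup X]
    [NormedSpace 𝕜 X] {ε : ℝ} {x y : X} (hx : ‖x‖ = 1) (hxy : x + y ≠ 0)
    {φ ψ : X →L[𝕜] 𝕜} (hφ : ‖φ‖ = 1) (hφx : φ x = 1) (hψ : ‖ψ‖ = 1)
    (hψu : ‖ψ ((‖x + y‖ : 𝕜)⁻¹ • (x + y))‖ = 1) (hd : ‖ψ - φ‖ ≤ ε) :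
    ‖x + y‖ ≤ 1 + RCLike.re (φ y) + (2 * ε + 2 * ‖y‖) * ‖y‖ := by
  have hN : (‖x + y‖ : 𝕜) ≠ 0 := by simpa using hxy
  set u : X := (‖x + y‖ : 𝕜)⁻¹ • (x + y) with hu
  have hun : ‖u‖ = 1 := norm_smul_inv_norm hxy
  have hux : ‖u - x‖ ≤ 2 * ‖y‖ := by
    simpa only [add_sub_cancel_left] using norm_normalize_sub_le (𝕜 := 𝕜) hx hxy
  set w : 𝕜 := ψ u with hw
  have hw1 : ‖w - 1‖ ≤ ε + 2 * ‖y‖ := by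
    have e : w - 1 = (ψ - φ) u + φ (u - x) := by simp [hw, hφx]
    rw [e]
    refine (norm_add_le _ _).trans (add_le_add ?_ ?_)
    · exact ((ψ - φ).le_opNorm u).trans (by rw [hun, mul_one]; exact hd)
    · exact (φ.le_opNorm _).trans (by rw [hφ, one_mul]; exact hux)
  have hcw : ‖(starRingEnd 𝕜) w - 1‖ ≤ ε + 2 * ‖y‖ := by
    rw [← RCLike.norm_conj]; simpa using hw1
  have hconj : ‖(starRingEnd 𝕜) w‖ = 1 := by rw [RCLike.norm_conj]; exact hψu
  have hval : (‖x + y‖ : 𝕜) = (starRingEnd 𝕜) w * ψ x + (starRingEnd 𝕜) w * ψ y := by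
    rw [← mul_add, ← map_add]
    have : x + y = (‖x + y‖ : 𝕜) • u := by rw [hu, smul_inv_smul₀ hN]
    conv_rhs => rw [this, map_smul, smul_eq_mul, ← hw, mul_left_comm, RCLike.conj_mul, hψu]
    simp
  have hre : ‖x + y‖ = RCLike.re ((starRingEnd 𝕜) w * ψ x)
      + RCLike.re ((starRingEnd 𝕜) w * ψ y) := by
    rw [← map_add, ← hval, RCLike.ofReal_re]
  have h1 : RCLike.re ((starRingEnd 𝕜) w * ψ x) ≤ 1 := by
    refine (RCLike.re_le_norm _).trans ?_
    rw [norm_mul, hconj, one_mul]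
    simpa [hψ, hx] using ψ.le_opNorm x
  have h2 : RCLike.re ((starRingEnd 𝕜) w * ψ y) - RCLike.re (φ y)
      ≤ (2 * ε + 2 * ‖y‖) * ‖y‖ := by
    rw [← map_sub]
    refine (RCLike.re_le_norm _).trans ?_
    have e : (starRingEnd 𝕜) w * ψ y - φ y
        = ((starRingEnd 𝕜) w - 1) * ψ y + (ψ - φ) y := by
      simp only [sub_apply]; ring
    rw [e]
    have b1 : ‖((starRingEnd 𝕜) w - 1) * ψ y‖ ≤ (ε + 2 * ‖y‖) * ‖y‖ := by
      rw [norm_mul]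
      have : ‖ψ y‖ ≤ ‖y‖ := by simpa [hψ] using ψ.le_opNorm y
      gcongr
      exact (norm_nonneg _).trans hcw
    have b2 : ‖(ψ - φ) y‖ ≤ ε * ‖y‖ := (ψ - φ).le_of_opNorm_le hd y
    linarith [norm_add_le (((starRingEnd 𝕜) w - 1) * ψ y) ((ψ - φ) y)]
  linarith

/-- The trivial bound `ρ_X(t) ≤ t`. -/
lemma modulusOfSmoothness_le_self (X : Type*) [NormedAddCommGroup X] {t : ℝ} (ht : 0 ≤ t) :
    modulusOfSmoothness X t ≤ t := by
  refine Real.sSup_le ?_ ht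
  rintro r ⟨x, y, hx, hy, rfl⟩
  linarith [norm_add_le x y, norm_sub_le x y]

/-- A quantitative estimate of the modulus of smoothness from the pointwise
Bishop–Phelps–Bollobás property of `(X, 𝕜)`. -/
lemma modulusOfSmoothness_le_of_pointwiseBPB {𝕜 X : Type*} [RCLike 𝕜] [NormedAddCommGroup X]
    [NormedSpace 𝕜 X] {ε δ : ℝ} (hε : 0 ≤ ε)
    (h : ∀ (f : X →L[𝕜] 𝕜) (x₀ : X), ‖f‖ = 1 → ‖x₀‖ = 1 →
      1 - δ < ‖f x₀‖ → ∃ g : X →L[𝕜] 𝕜, ‖g‖ = 1 ∧ ‖g x₀‖ = 1 ∧ ‖g - f‖ < ε)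
    {t : ℝ} (ht0 : 0 ≤ t) (ht1 : t < 1) (htδ : 2 * t < δ) :
    modulusOfSmoothness X t ≤ (2 * ε + 2 * t) * t := by
  refine Real.sSup_le ?_ (by positivity)
  rintro r ⟨x, y, hx, hy, rfl⟩
  have hx0 : ‖x‖ ≠ 0 := by simp [hx]
  obtain ⟨φ, hφ, hφx⟩ := exists_dual_vector 𝕜 x hx0
  have hφx : φ x = 1 := by simpa [hx] using hφx
  have key : ∀ y : X, ‖y‖ ≤ t →
      ‖x + y‖ ≤ 1 + RCLike.re (φ y) + (2 * ε + 2 * t) * t := by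
    intro y hy
    have hxy : x + y ≠ 0 := by
      intro h0
      have : ‖y‖ = 1 := by rw [← hx, eq_neg_of_add_eq_zero_right h0, norm_neg]
      linarith
    have hux : ‖(‖x + y‖ : 𝕜)⁻¹ • (x + y) - x‖ ≤ 2 * ‖y‖ := by
      simpa only [add_sub_cancel_left] using norm_normalize_sub_le (𝕜 := 𝕜) hx hxy
    obtain ⟨ψ, hψ, hψu, hd⟩ := h φ ((‖x + y‖ : 𝕜)⁻¹ • (x + y)) hφ
      (norm_smul_inv_norm hxy) (by
        set u : X := (‖x + y‖ : 𝕜)⁻¹ • (x + y)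
        have h1 : ‖φ (u - x)‖ ≤ ‖u - x‖ := by simpa [hφ] using φ.le_opNorm (u - x)
        rw [map_sub, hφx] at h1
        have h2 := norm_sub_norm_le 1 (φ u)
        rw [norm_one, norm_sub_rev] at h2
        linarith)
    refine (norm_add_le_of_norm_attaining hx hxy hφ hφx hψ hψu hd.le).trans ?_
    gcongr
  have h1 := key y hy
  have h2 := key (-y) (by rwa [norm_neg])
  rw [← sub_eq_add_neg, map_neg, map_neg] at h2
  linarith

/-- If `(X, 𝕜)` has the pointwise BPB property with a function `η̃`, then for
every `ε ∈ (0,1)` and every `0 < t ≤ 1` with `t < η̃(ε)/2`, the modulus of smoothness satisfies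
`ρ_X(t)/t < 2ε + 4√(η̃(ε) + ε)`. -/
theorem modulusOfSmoothness_lt_of_pointwiseBPB_scalar {𝕜 : Type*} [RCLike 𝕜]
    {X : Type*} [NormedAddCommGroup X] [NormedSpace 𝕜 X] [CompleteSpace X] [Nontrivial X]
    (η : ℝ → ℝ) (hηpos : ∀ ε ∈ Set.Ioo (0:ℝ) 1, 0 < η ε)
    (h : ∀ ε ∈ Set.Ioo (0:ℝ) 1, ∀ (f : X →L[𝕜] 𝕜) (x₀ : X), ‖f‖ = 1 → ‖x₀‖ = 1 →
      1 - η ε < ‖f x₀‖ → ∃ g : X →L[𝕜] 𝕜, ‖g‖ = 1 ∧ ‖g x₀‖ = 1 ∧ ‖g - f‖ < ε) :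
    ∀ ε ∈ Set.Ioo (0:ℝ) 1, ∀ t : ℝ, 0 < t → t ≤ 1 → t < η ε / 2 →
      modulusOfSmoothness X t / t < 2 * ε + 4 * Real.sqrt (η ε + ε) := by
  intro ε hε t ht0 _ htη
  obtain ⟨hε0, hε1⟩ := hε
  have hη := hηpos ε ⟨hε0, hε1⟩
  rw [div_lt_iff₀ ht0]
  set s := Real.sqrt (η ε + ε)
  have hs0 : 0 ≤ s := Real.sqrt_nonneg _
  have hs : s ^ 2 = η ε + ε := Real.sq_sqrt (by linarith)
  by_cases hs1 : 1 ≤ s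
  · refine (modulusOfSmoothness_le_self X ht0.le).trans_lt ?_
    nlinarith
  · push Not at hs1
    refine (modulusOfSmoothness_le_of_pointwiseBPB hε0.le (h ε ⟨hε0, hε1⟩) ht0.le
      (by nlinarith) (by linarith)).trans_lt ?_
    refine mul_lt_mul_of_pos_right ?_ ht0
    nlinarith

end
end

section
/- Let Y be a nonzero Banach space and let ε ∈ (0, 1). Then inf{η̃(X, Y)(ε) : X a uniformly smooth Banach space} = 0. Equivalently, for every ρ > 0 there exist a uniformly smooth Banach space X, a bounded linear operator T : X → Y with ‖T‖ = 1, and a point x with ‖x‖ = 1 such that ‖T x‖ > 1 − ρ, yet every bounded linear operator S : X → Y with ‖S‖ = 1 = ‖S x‖ satisfies ‖S − T‖ ≥ ε. -/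
open scoped Topology ENNReal
open Filter Metric

noncomputable section

/-- A second-order bound for even powers of two nonnegative reals tied by the parallelogram law. -/
theorem exists_pow_add_pow_le (m : ℕ) :
    ∃ C : ℝ, 0 ≤ C ∧ ∀ a h u v : ℝ, 0 ≤ a → a ≤ 1 → 0 ≤ u → u ≤ 2 → 0 ≤ v → v ≤ 2 →
      |u - v| ≤ 2 * h → u ^ 2 + v ^ 2 = 2 * (a ^ 2 + h ^ 2) →
      (u ^ 2) ^ m + (v ^ 2) ^ m ≤ 2 * (a ^ 2) ^ m + C * h ^ 2 := by
  induction m with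
  | zero => exact ⟨0, le_rfl, fun a h u v _ _ _ _ _ _ _ _ => by norm_num⟩
  | succ m ih =>
    obtain ⟨C, hC, ih⟩ := ih
    refine ⟨C + 2 * 4 ^ m + 32 * (m * 4 ^ (m - 1)), by positivity, ?_⟩
    intro a h u v ha ha1 hu hu2 hv hv2 huv hpar
    have hD := ih a h u v ha ha1 hu hu2 hv hv2 huv hpar
    have hU4 : u ^ 2 ≤ 4 := by nlinarith
    have hV4 : v ^ 2 ≤ 4 := by nlinarith
    have hUm : (u ^ 2) ^ m ≤ 4 ^ m := pow_le_pow_left₀ (by positivity) hU4 m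
    have hVm : (v ^ 2) ^ m ≤ 4 ^ m := pow_le_pow_left₀ (by positivity) hV4 m
    have hlip : |(u ^ 2) ^ m - (v ^ 2) ^ m| ≤ |u ^ 2 - v ^ 2| * (m * 4 ^ (m - 1)) := by
      refine (abs_pow_sub_pow_le _ _ m).trans ?_
      rw [mul_assoc]
      gcongr
      exact max_le (by rwa [abs_of_nonneg (by positivity)])
        (by rwa [abs_of_nonneg (by positivity)])
    have hdiff : |u ^ 2 - v ^ 2| ≤ 8 * h := by
      rw [sq_sub_sq, abs_mul, abs_of_nonneg (by positivity : 0 ≤ u + v)]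
      nlinarith [abs_nonneg (u - v)]
    have hcross : (u ^ 2 - v ^ 2) * ((u ^ 2) ^ m - (v ^ 2) ^ m)
        ≤ 64 * h ^ 2 * (m * 4 ^ (m - 1)) := by
      calc (u ^ 2 - v ^ 2) * ((u ^ 2) ^ m - (v ^ 2) ^ m)
          ≤ |u ^ 2 - v ^ 2| * |(u ^ 2) ^ m - (v ^ 2) ^ m| := by
            rw [← abs_mul]; exact le_abs_self _
        _ ≤ |u ^ 2 - v ^ 2| * (|u ^ 2 - v ^ 2| * (m * 4 ^ (m - 1))) := by gcongr
        _ = |u ^ 2 - v ^ 2| ^ 2 * (m * 4 ^ (m - 1)) := by ring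
        _ ≤ (8 * h) ^ 2 * (m * 4 ^ (m - 1)) := by gcongr
        _ = 64 * h ^ 2 * (m * 4 ^ (m - 1)) := by ring
    have hsplit : (u ^ 2) ^ (m + 1) + (v ^ 2) ^ (m + 1)
        = (a ^ 2 + h ^ 2) * ((u ^ 2) ^ m + (v ^ 2) ^ m)
          + (u ^ 2 - v ^ 2) * ((u ^ 2) ^ m - (v ^ 2) ^ m) / 2 := by
      linear_combination ((u ^ 2) ^ m + (v ^ 2) ^ m) / 2 * hpar
    have ha2 : a ^ 2 ≤ 1 := by nlinarith
    have h1 : a ^ 2 * ((u ^ 2) ^ m + (v ^ 2) ^ m) ≤ 2 * (a ^ 2) ^ (m + 1) + C * h ^ 2 := by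
      calc a ^ 2 * ((u ^ 2) ^ m + (v ^ 2) ^ m)
          ≤ a ^ 2 * (2 * (a ^ 2) ^ m + C * h ^ 2) := by gcongr
        _ = 2 * (a ^ 2) ^ (m + 1) + a ^ 2 * (C * h ^ 2) := by ring
        _ ≤ 2 * (a ^ 2) ^ (m + 1) + 1 * (C * h ^ 2) := by gcongr
        _ = _ := by ring
    have h2 : h ^ 2 * ((u ^ 2) ^ m + (v ^ 2) ^ m) ≤ h ^ 2 * (4 ^ m + 4 ^ m) := by gcongr
    rw [hsplit]
    nlinarith

theorem PiLp.norm_pow_eq_sum {ι : Type*} [Fintype ι] {E : ι → Type*}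
    [∀ i, NormedAddCommGroup (E i)] {n : ℕ} (hn : n ≠ 0) (x : PiLp (n : ℝ≥0∞) E) :
    ‖x‖ ^ n = ∑ i, ‖x i‖ ^ n := by
  have hpos : 0 < ((n : ℝ≥0∞)).toReal := by
    rw [ENNReal.toReal_natCast]; exact_mod_cast Nat.pos_of_ne_zero hn
  rw [PiLp.norm_eq_sum hpos, ENNReal.toReal_natCast, one_div,
    Real.rpow_inv_natCast_pow (by positivity) hn]
  simp only [Real.rpow_natCast]

/-- A quadratic bound on the second differences of the norm gives uniform smoothness. -/
theorem UniformlySmooth.of_quadratic_bound (𝕜 : Type*) [RCLike 𝕜] {X : Type*}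
    [NormedAddCommGroup X] [NormedSpace 𝕜 X] {C : ℝ}
    (h : ∀ x y : X, ‖x‖ = 1 → ‖y‖ ≤ 1 → ‖x + y‖ + ‖x - y‖ - 2 ≤ C * ‖y‖ ^ 2) (hC : 0 ≤ C) :
    UniformlySmooth X := by
  have hlim : Tendsto (fun t : ℝ => C * t) (𝓝[>] (0 : ℝ)) (𝓝 0) := by
    have : Tendsto (fun t : ℝ => C * t) (𝓝 0) (𝓝 (C * 0)) := by
      exact (continuous_const.mul continuous_id).tendsto 0
    rw [mul_zero] at this
    exact this.mono_left nhdsWithin_le_nhds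
  refine tendsto_of_tendsto_of_tendsto_of_le_of_le' tendsto_const_nhds hlim ?_ ?_
  · filter_upwards [self_mem_nhdsWithin] with t ht
    refine div_nonneg (Real.sSup_nonneg ?_) (le_of_lt ht)
    rintro r ⟨x, y, hx, -, rfl⟩
    have h2 : ‖(x + y) + (x - y)‖ = 2 * ‖x‖ := by
      rw [add_add_sub_cancel, ← two_smul 𝕜, norm_smul, RCLike.norm_two]
    have := norm_add_le (x + y) (x - y)
    linarith
  · filter_upwards [self_mem_nhdsWithin, nhdsWithin_le_nhds (Iio_mem_nhds one_pos)] with t ht ht1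
    have ht0 : (0 : ℝ) < t := ht
    rw [div_le_iff₀ ht0]
    refine Real.sSup_le ?_ (by positivity)
    rintro r ⟨x, y, hx, hy, rfl⟩
    have h1 := h x y hx (hy.trans (le_of_lt ht1))
    have h2 : C * ‖y‖ ^ 2 ≤ C * t ^ 2 := by gcongr
    nlinarith [mul_nonneg hC (sq_nonneg t)]

/-- A finite `ℓ^p` sum of inner product spaces is uniformly smooth when `p` is even. -/
theorem PiLp.uniformlySmooth_of_even (𝕜 : Type*) [RCLike 𝕜] {ι : Type*} [Fintype ι]
    {E : ι → Type*} [∀ i, NormedAddCommGroup (E i)] [∀ i, InnerProductSpace 𝕜 (E i)] {m : ℕ}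
    (hm : m ≠ 0) [Fact (1 ≤ ((2 * m : ℕ) : ℝ≥0∞))] :
    UniformlySmooth (PiLp ((2 * m : ℕ) : ℝ≥0∞) E) := by
  obtain ⟨C, hC, hpow⟩ := exists_pow_add_pow_le m
  have hn : 2 * m ≠ 0 := by omega
  refine UniformlySmooth.of_quadratic_bound 𝕜 (C := Fintype.card ι * C) (fun x y hx hy => ?_)
    (by positivity)
  have hcoord : ∀ i, ‖(x + y) i‖ ^ (2 * m) + ‖(x - y) i‖ ^ (2 * m)
      ≤ 2 * ‖x i‖ ^ (2 * m) + C * ‖y‖ ^ 2 := by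
    intro i
    have hxi : ‖x i‖ ≤ 1 := hx ▸ PiLp.norm_apply_le x i
    have hyi : ‖y i‖ ≤ ‖y‖ := PiLp.norm_apply_le y i
    have huv : |‖x i + y i‖ - ‖x i - y i‖| ≤ 2 * ‖y i‖ := by
      refine (abs_norm_sub_norm_le _ _).trans ?_
      rw [add_sub_sub_cancel]
      exact (norm_add_le _ _).trans_eq (two_mul _).symm
    have hpar := parallelogram_law_with_norm 𝕜 (x i) (y i)
    have := hpow ‖x i‖ ‖y i‖ ‖x i + y i‖ ‖x i - y i‖ (norm_nonneg _) hxi (norm_nonneg _)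
      (by linarith [norm_add_le (x i) (y i)]) (norm_nonneg _)
      (by linarith [norm_sub_le (x i) (y i)]) huv (by linarith)
    simp only [← pow_mul] at this
    have h2 : C * ‖y i‖ ^ 2 ≤ C * ‖y‖ ^ 2 := by gcongr
    exact this.trans (by gcongr)
  have hsum : ‖x + y‖ ^ (2 * m) + ‖x - y‖ ^ (2 * m) ≤ 2 + Fintype.card ι * C * ‖y‖ ^ 2 := by
    have hx1 := PiLp.norm_pow_eq_sum hn x
    rw [hx, one_pow] at hx1
    calc ‖x + y‖ ^ (2 * m) + ‖x - y‖ ^ (2 * m)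
        = ∑ i, (‖(x + y) i‖ ^ (2 * m) + ‖(x - y) i‖ ^ (2 * m)) := by
          rw [PiLp.norm_pow_eq_sum hn, PiLp.norm_pow_eq_sum hn, Finset.sum_add_distrib]
      _ ≤ ∑ i, (2 * ‖x i‖ ^ (2 * m) + C * ‖y‖ ^ 2) := Finset.sum_le_sum fun i _ => hcoord i
      _ = 2 + Fintype.card ι * C * ‖y‖ ^ 2 := by
          rw [Finset.sum_add_distrib, ← Finset.mul_sum, ← hx1]
          simp [mul_assoc]
  have hbern : ∀ z : PiLp ((2 * m : ℕ) : ℝ≥0∞) E, ‖z‖ ^ (2 * m) - 1 ≥ (2 * m : ℕ) * (‖z‖ - 1) := by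
    intro z
    have := one_add_mul_le_pow (a := ‖z‖ - 1) (by linarith [norm_nonneg z]) (2 * m)
    rw [add_sub_cancel] at this
    linarith
  have hn1 : (1 : ℝ) ≤ (2 * m : ℕ) := by exact_mod_cast Nat.one_le_iff_ne_zero.mpr hn
  have hR : 0 ≤ Fintype.card ι * C * ‖y‖ ^ 2 := by positivity
  have hp := hbern (x + y)
  have hq := hbern (x - y)
  by_contra! hlt
  nlinarith

/-- If `n * c` bounds the slopes of `s ↦ s ^ n` between `s` and `α` for all `s < α`, then it bounds
the derivative at `α`. -/
theorem pow_pred_le_of_forall_pow_sub_pow_le {n : ℕ} (hn : n ≠ 0) {α c : ℝ} (hα : 0 < α)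
    (h : ∀ s, 0 < s → s < α → α ^ n - s ^ n ≤ n * (α - s) * c) : α ^ (n - 1) ≤ c := by
  have hlim : Tendsto (fun s : ℝ => s ^ (n - 1)) (𝓝[<] α) (𝓝 (α ^ (n - 1))) :=
    ((continuous_pow (n - 1)).tendsto α).mono_left nhdsWithin_le_nhds
  refine le_of_tendsto hlim ?_
  filter_upwards [self_mem_nhdsWithin, nhdsWithin_le_nhds (Ioi_mem_nhds hα)] with s hs hs0
  have hsα : s < α := hs
  have hs0' : 0 < s := hs0
  have hbern := one_add_mul_le_pow (a := α / s - 1)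
    (by linarith [div_nonneg hα.le hs0'.le]) n
  rw [add_sub_cancel, div_pow, le_div_iff₀ (by positivity)] at hbern
  obtain ⟨k, rfl⟩ := Nat.exists_eq_succ_of_ne_zero hn
  have hexp : (1 + ((k + 1 : ℕ) : ℝ) * (α / s - 1)) * s ^ (k + 1)
      = s ^ (k + 1) + ((k + 1 : ℕ) : ℝ) * (α - s) * s ^ k := by
    field_simp
    ring
  have hpos : 0 < ((k + 1 : ℕ) : ℝ) * (α - s) :=
    mul_pos (by positivity) (by linarith)
  have hle := h s hs0' hsα
  simp only [Nat.succ_eq_add_one, add_tsub_cancel_right] at *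
  rw [hexp] at hbern
  refine le_of_mul_le_mul_left ?_ hpos
  linarith

/-- For every nonzero Banach space `Y` and every `ε ∈ (0,1)`,
`inf { η̃(X,Y)(ε) : X uniformly smooth } = 0`: for every `ρ > 0` there are a uniformly smooth
Banach space `X`, a norm-one operator `T : X → Y` and a norm-one point `x` with
`‖T x‖ > 1 - ρ`, such that every norm-one `S` attaining its norm at `x` satisfies
`‖S - T‖ ≥ ε`. -/
theorem no_universal_function_for_range {𝕜 : Type} [RCLike 𝕜]
    (Y : Type) [NormedAddCommGroup Y] [NormedSpace 𝕜 Y] [CompleteSpace Y] [Nontrivial Y]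
    (ε : ℝ) (hε : ε ∈ Set.Ioo (0:ℝ) 1) :
    ∀ ρ : ℝ, 0 < ρ →
      ∃ (X : Type) (_ : NormedAddCommGroup X) (_ : NormedSpace 𝕜 X) (_ : CompleteSpace X),
        UniformlySmooth X ∧
        ∃ (T : X →L[𝕜] Y) (x : X), ‖T‖ = 1 ∧ ‖x‖ = 1 ∧ 1 - ρ < ‖T x‖ ∧
          ∀ S : X →L[𝕜] Y, ‖S‖ = 1 → ‖S x‖ = 1 → ε ≤ ‖S - T‖ := by
  intro ρ hρ
  obtain ⟨hε0, hε1⟩ := hε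
  obtain ⟨m, hm0, hmρ⟩ : ∃ m : ℕ, m ≠ 0 ∧ (max (1 - ρ) 0) ^ (2 * m) < 1 - ε := by
    have hlim := tendsto_pow_atTop_nhds_zero_of_lt_one (r := max (1 - ρ) 0 ^ 2) (by positivity)
      (pow_lt_one₀ (by positivity) (max_lt (by linarith) one_pos) two_ne_zero)
    obtain ⟨m, hm, hm0⟩ := ((hlim.eventually (gt_mem_nhds (sub_pos.mpr hε1))).and
      (eventually_ne_atTop 0)).exists
    exact ⟨m, hm0, by rwa [pow_mul]⟩
  have hn : 2 * m ≠ 0 := by omega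
  obtain ⟨α, hα0, hαn⟩ : ∃ α : ℝ, 0 < α ∧ α ^ (2 * m) = ε :=
    ⟨ε ^ (((2 * m : ℕ) : ℝ)⁻¹), by positivity, Real.rpow_inv_natCast_pow hε0.le hn⟩
  obtain ⟨β, hβ0, hβn⟩ : ∃ β : ℝ, 0 < β ∧ β ^ (2 * m) = 1 - ε :=
    ⟨(1 - ε) ^ (((2 * m : ℕ) : ℝ)⁻¹), Real.rpow_pos_of_pos (by linarith) _,
      Real.rpow_inv_natCast_pow (by linarith) hn⟩
  have hα1 : α ≤ 1 := (pow_le_one_iff_of_nonneg hα0.le hn).mp (by linarith)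
  have hβρ : 1 - ρ < β :=
    (le_max_left _ 0).trans_lt (lt_of_pow_lt_pow_left₀ (2 * m) hβ0.le (by rwa [hβn]))
  have hfact : Fact (1 ≤ ((2 * m : ℕ) : ℝ≥0∞)) :=
    ⟨by exact_mod_cast Nat.one_le_iff_ne_zero.mpr hn⟩
  obtain ⟨y, hy⟩ : ∃ y : Y, ‖y‖ = 1 := by
    obtain ⟨z, hz⟩ := exists_ne (0 : Y)
    exact ⟨((‖z‖⁻¹ : ℝ) : 𝕜) • z, by simpa using norm_smul_inv_norm (𝕜 := 𝕜) hz⟩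
  have hnorm : ∀ a b : 𝕜, ‖(WithLp.toLp ((2 * m : ℕ) : ℝ≥0∞) ![a, b] :
      PiLp ((2 * m : ℕ) : ℝ≥0∞) (fun _ : Fin 2 => 𝕜))‖ ^ (2 * m)
        = ‖a‖ ^ (2 * m) + ‖b‖ ^ (2 * m) := by
    intro a b
    rw [PiLp.norm_pow_eq_sum hn]
    simp [Fin.sum_univ_two]
  let T : PiLp ((2 * m : ℕ) : ℝ≥0∞) (fun _ : Fin 2 => 𝕜) →L[𝕜] Y :=
    (PiLp.proj (𝕜 := 𝕜) ((2 * m : ℕ) : ℝ≥0∞) (fun _ : Fin 2 => 𝕜) 1).smulRight y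
  have hT : ∀ z, T z = z 1 • y := fun z => rfl
  let e₁ : PiLp ((2 * m : ℕ) : ℝ≥0∞) (fun _ : Fin 2 => 𝕜) := WithLp.toLp _ ![1, 0]
  let e₂ : PiLp ((2 * m : ℕ) : ℝ≥0∞) (fun _ : Fin 2 => 𝕜) := WithLp.toLp _ ![0, 1]
  let x : PiLp ((2 * m : ℕ) : ℝ≥0∞) (fun _ : Fin 2 => 𝕜) := WithLp.toLp _ ![(α : 𝕜), (β : 𝕜)]
  have he₁ : ‖e₁‖ = 1 :=
    (pow_eq_one_iff_of_nonneg (norm_nonneg _) hn).mp (by rw [hnorm]; simp [hn])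
  have he₂ : ‖e₂‖ = 1 :=
    (pow_eq_one_iff_of_nonneg (norm_nonneg _) hn).mp (by rw [hnorm]; simp [hn])
  have hx : ‖x‖ = 1 :=
    (pow_eq_one_iff_of_nonneg (norm_nonneg _) hn).mp (by
      rw [hnorm, RCLike.norm_of_nonneg hα0.le, RCLike.norm_of_nonneg hβ0.le, hαn, hβn]; ring)
  refine ⟨PiLp ((2 * m : ℕ) : ℝ≥0∞) (fun _ : Fin 2 => 𝕜), inferInstance, inferInstance,
    inferInstance, PiLp.uniformlySmooth_of_even 𝕜 hm0, T, x, ?_, hx, ?_, ?_⟩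
  · refine le_antisymm (T.opNorm_le_bound zero_le_one fun z => ?_) ?_
    · rw [hT, norm_smul, hy, mul_one, one_mul]
      exact PiLp.norm_apply_le z 1
    · have := T.le_opNorm e₂
      simpa [hT, e₂, he₂, hy, norm_smul] using this
  · have : ‖T x‖ = β := by
      simp [hT, x, norm_smul, hy, abs_of_pos hβ0]
    rwa [this]
  · intro S hS hSx
    have hTe : T e₁ = 0 := by simp [hT, e₁]
    have hSe1 : ‖S e₁‖ ≤ 1 := by simpa [hS, he₁] using S.le_opNorm e₁
    have hST : ‖S e₁‖ ≤ ‖S - T‖ := by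
      simpa [hTe, he₁] using (S - T).le_opNorm e₁
    have hslope : α ^ (2 * m - 1) ≤ ‖S e₁‖ := by
      refine pow_pred_le_of_forall_pow_sub_pow_le hn hα0 fun s hs hsα => ?_
      have hxs : x - ((α - s : ℝ) : 𝕜) • e₁ = WithLp.toLp _ ![(s : 𝕜), (β : 𝕜)] := by
        ext i
        fin_cases i <;> simp [x, e₁]
      have hlow : 1 - (α - s) * ‖S e₁‖ ≤ ‖x - ((α - s : ℝ) : 𝕜) • e₁‖ := by
        calc 1 - (α - s) * ‖S e₁‖ = ‖S x‖ - ‖((α - s : ℝ) : 𝕜) • S e₁‖ := by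
              rw [hSx, norm_smul, RCLike.norm_of_nonneg (by linarith)]
          _ ≤ ‖S (x - ((α - s : ℝ) : 𝕜) • e₁)‖ := by
              rw [map_sub, map_smul]; exact norm_sub_norm_le _ _
          _ ≤ ‖x - ((α - s : ℝ) : 𝕜) • e₁‖ := by
              simpa only [hS, one_mul] using S.le_opNorm (x - ((α - s : ℝ) : 𝕜) • e₁)
      have hle1 : (α - s) * ‖S e₁‖ ≤ 1 := mul_le_one₀ (by linarith) (norm_nonneg _) hSe1
      have hpow := pow_le_pow_left₀ (by linarith) hlow (2 * m)
      rw [hxs, hnorm, RCLike.norm_of_nonneg hs.le, RCLike.norm_of_nonneg hβ0.le, hβn] at hpow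
      have hbern := one_add_mul_le_pow (a := -((α - s) * ‖S e₁‖)) (by linarith) (2 * m)
      rw [← sub_eq_add_neg] at hbern
      linarith
    calc ε = α ^ (2 * m) := hαn.symm
      _ ≤ α ^ (2 * m - 1) := pow_le_pow_of_le_one hα0.le hα1 (Nat.sub_le _ _)
      _ ≤ ‖S e₁‖ := hslope
      _ ≤ ‖S - T‖ := hST

end
end

section
/- Let (X, ‖·‖) be a normed space and let N : X → ℝ be another norm on X (N(x + y) ≤ N(x) + N(y), N(a·x) = |a|·N(x), and N(x) = 0 iff x = 0). Suppose there are δ ∈ (0, 1], q ∈ [2, ∞) and c > 0 such that N(x) ≤ ‖x‖ ≤ c·N(x) for all x, and (N(x + y)/2)^q + δ·(N(x − y)/2)^q ≤ (N(x)^q + N(y)^q)/2 for all x, y ∈ X. For n ∈ ℕ, n ≥ 1, define ‖x‖_n = (‖x‖^q + (1/n)·N(x)^q)^{1/q}. Then for every ε ∈ (0, 2) and all x, y ∈ X with ‖x‖_n = ‖y‖_n = 1 and ‖x − y‖_n ≥ ε, one has ‖(x + y)/2‖_n ≤ (1 − δε^q/(2^q(n c^q + 1)))^{1/q} ≤ 1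 − δε^q/(q·2^q(n c^q + 1)). -/
open scoped Topology ENNReal
open Filter Metric

noncomputable section

/-- Midpoint convexity of `t ↦ t ^ q` along a norm. -/
theorem norm_half_smul_add_rpow_le {X : Type*} [NormedAddCommGroup X] [NormedSpace ℝ X]
    {q : ℝ} (hq : 1 ≤ q) (x y : X) :
    ‖(2:ℝ)⁻¹ • (x + y)‖ ^ q ≤ (‖x‖ ^ q + ‖y‖ ^ q) / 2 := by
  have hnorm : ‖(2:ℝ)⁻¹ • (x + y)‖ ≤ 2⁻¹ * ‖x‖ + 2⁻¹ * ‖y‖ := by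
    rw [norm_smul, Real.norm_of_nonneg (by norm_num)]
    linarith [norm_add_le x y]
  have hconvex := (convexOn_rpow hq).2 (Set.mem_Ici.2 (norm_nonneg x))
    (Set.mem_Ici.2 (norm_nonneg y)) (by norm_num : (0:ℝ) ≤ 2⁻¹) (by norm_num : (0:ℝ) ≤ 2⁻¹)
    (by norm_num)
  simp only [smul_eq_mul] at hconvex
  have hmono := Real.rpow_le_rpow (norm_nonneg _) hnorm (by linarith : (0:ℝ) ≤ q)
  linarith

/-- Lemma 1 of the paper. Modulus-of-convexity estimate for the renormings
`‖x‖_n = (‖x‖^q + (1/n) N(x)^q)^{1/q}`. -/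
theorem renorming_modulus_estimate {X : Type*} [NormedAddCommGroup X] [NormedSpace ℝ X]
    (N : X → ℝ)
    (hN_add : ∀ x y : X, N (x + y) ≤ N x + N y)
    (hN_smul : ∀ (a : ℝ) (x : X), N (a • x) = |a| * N x)
    (hN_zero : ∀ x : X, N x = 0 ↔ x = 0)
    (δ q c : ℝ) (hδ : δ ∈ Set.Ioc (0:ℝ) 1) (hq : 2 ≤ q) (hc : 0 < c)
    (hle : ∀ x : X, N x ≤ ‖x‖ ∧ ‖x‖ ≤ c * N x)
    (hconv : ∀ x y : X,
      (N (x + y) / 2) ^ q + δ * (N (x - y) / 2) ^ q ≤ (N x ^ q + N y ^ q) / 2)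
    (n : ℕ) (hn : 1 ≤ n) :
    ∀ ε ∈ Set.Ioo (0:ℝ) 2, ∀ x y : X,
      (‖x‖ ^ q + (1 / (n:ℝ)) * N x ^ q) ^ (1/q) = 1 →
      (‖y‖ ^ q + (1 / (n:ℝ)) * N y ^ q) ^ (1/q) = 1 →
      ε ≤ (‖x - y‖ ^ q + (1 / (n:ℝ)) * N (x - y) ^ q) ^ (1/q) →
      (‖(2:ℝ)⁻¹ • (x + y)‖ ^ q + (1 / (n:ℝ)) * N ((2:ℝ)⁻¹ • (x + y)) ^ q) ^ (1/q)
          ≤ (1 - δ * ε ^ q / (2 ^ q * ((n:ℝ) * c ^ q + 1))) ^ (1/q) ∧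
        (1 - δ * ε ^ q / (2 ^ q * ((n:ℝ) * c ^ q + 1))) ^ (1/q)
          ≤ 1 - δ * ε ^ q / (q * 2 ^ q * ((n:ℝ) * c ^ q + 1)) := by
  rintro ε ⟨hε, -⟩ x y hx hy hxy
  have hq0 : 0 < q := by linarith
  have hn0 : (0:ℝ) < n := by exact_mod_cast hn
  have hN (z : X) : 0 ≤ N z :=
    nonneg_of_mul_nonneg_right ((norm_nonneg z).trans (hle z).2) hc
  have hsum (z : X) : 0 ≤ ‖z‖ ^ q + (1 / (n:ℝ)) * N z ^ q := by
    have := hN z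
    positivity
  have sum_eq_one (z : X) (hz : (‖z‖ ^ q + (1 / (n:ℝ)) * N z ^ q) ^ (1/q) = 1) :
      ‖z‖ ^ q + (1 / (n:ℝ)) * N z ^ q = 1 := by
    rw [one_div q, Real.rpow_inv_eq (hsum z) zero_le_one hq0.ne', Real.one_rpow] at hz
    exact hz
  have hx1 := sum_eq_one x hx
  have hy1 := sum_eq_one y hy
  have hε_le : ε ^ q ≤ ‖x - y‖ ^ q + (1 / (n:ℝ)) * N (x - y) ^ q := by
    rwa [one_div q, Real.le_rpow_inv_iff_of_pos hε.le (hsum _) hq0] at hxy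
  have hnorm_le : ‖x - y‖ ^ q ≤ c ^ q * N (x - y) ^ q := by
    rw [← Real.mul_rpow hc.le (hN _)]
    exact Real.rpow_le_rpow (norm_nonneg _) (hle _).2 hq0.le
  have hD : 0 < (n:ℝ) * c ^ q + 1 := by positivity
  have hdiff : ε ^ q / (n * c ^ q + 1) ≤ (1 / (n:ℝ)) * N (x - y) ^ q := by
    rw [div_le_iff₀ hD]
    calc ε ^ q ≤ c ^ q * N (x - y) ^ q + (1 / (n:ℝ)) * N (x - y) ^ q := by linarith
      _ = (1 / (n:ℝ)) * N (x - y) ^ q * (n * c ^ q + 1) := by field_simp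
  have hhalf : N ((2:ℝ)⁻¹ • (x + y)) = N (x + y) / 2 := by
    rw [hN_smul, abs_of_pos (by norm_num), inv_mul_eq_div]
  have hmid : ‖(2:ℝ)⁻¹ • (x + y)‖ ^ q + (1 / (n:ℝ)) * N ((2:ℝ)⁻¹ • (x + y)) ^ q
      ≤ 1 - δ * ε ^ q / (2 ^ q * ((n:ℝ) * c ^ q + 1)) := by
    have hnorm := norm_half_smul_add_rpow_le (by linarith : 1 ≤ q) x y
    have hNmid := mul_le_mul_of_nonneg_left (hconv x y) (by positivity : 0 ≤ 1 / (n:ℝ))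
    have hgap : δ * ε ^ q / (2 ^ q * ((n:ℝ) * c ^ q + 1))
        ≤ (1 / (n:ℝ)) * (δ * (N (x - y) / 2) ^ q) := by
      calc _ = δ / 2 ^ q * (ε ^ q / (n * c ^ q + 1)) := by field_simp
        _ ≤ δ / 2 ^ q * ((1 / (n:ℝ)) * N (x - y) ^ q) :=
          mul_le_mul_of_nonneg_left hdiff (div_nonneg hδ.1.le (by positivity))
        _ = _ := by rw [Real.div_rpow (hN _) zero_le_two]; ring
    rw [hhalf]
    linarith
  refine ⟨Real.rpow_le_rpow (hsum _) hmid (by positivity), ?_⟩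
  have hbernoulli := rpow_one_add_le_one_add_mul_self
    (s := -(δ * ε ^ q / (2 ^ q * ((n:ℝ) * c ^ q + 1)))) (p := 1 / q)
    (by linarith [(hsum _).trans hmid]) (by positivity)
    ((div_le_one hq0).2 (by linarith))
  calc _ ≤ 1 + 1 / q * -(δ * ε ^ q / (2 ^ q * ((n:ℝ) * c ^ q + 1))) := by
        rwa [← sub_eq_add_neg] at hbernoulli
    _ = _ := by field_simp; ring

end
end

section
/- Let X be a real vector space and let p₁, p₂ be two norms on X with p₂(x) ≤ p₁(x) for all x ∈ X. Let δ₁ : (0, 2] → ℝ be the modulus of convexity of (X, p₁), i.e. δ₁(t) = inf{1 − p₁((x + y)/2) : p₁(x) ≤ 1, p₁(y) ≤ 1, p₁(x − y) ≥ t}, and assume δ₁ and t ↦ δ₁(t)/t are non-decreasing. Define ‖x‖ = p₁(x) + p₂(x). Then for every t ∈ (0, 1) and all x, y ∈ X with ‖x‖ = ‖y‖ = 1 and ‖x − y‖ ≥ t, one has ‖(x + y)/2‖ ≤ 1 − δ₁(t/4); consequently the modulus of convexity δ of (X, ‖·‖) satisfies δ(t) ≥ δ₁(t/4) for every t ∈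 (0, 1). -/
open scoped Topology ENNReal
open Filter Metric

noncomputable section

/-- The modulus of convexity of an abstract norm `p` on a real vector space. -/
def modulusOfConvexityFor {X : Type*} [AddCommGroup X] [Module ℝ X] (p : X → ℝ) (t : ℝ) : ℝ :=
  sInf {r : ℝ | ∃ x y : X, p x ≤ 1 ∧ p y ≤ 1 ∧ t ≤ p (x - y) ∧
    r = 1 - p ((2:ℝ)⁻¹ • (x + y))}

section AbstractNorm

variable {X : Type*} [AddCommGroup X] [Module ℝ X] {p : X → ℝ}

theorem nonneg_of_add_le_of_smul (hadd : ∀ x y : X, p (x + y) ≤ p x + p y)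
    (hsmul : ∀ (a : ℝ) (x : X), p (a • x) = |a| * p x) (x : X) : 0 ≤ p x := by
  have h0 : p 0 = 0 := by simpa using hsmul 0 0
  have hneg : p (-x) = p x := by simpa using hsmul (-1) x
  have h := hadd x (-x)
  rw [add_neg_cancel, h0, hneg] at h
  linarith

theorem modulusOfConvexityFor_le (hadd : ∀ x y : X, p (x + y) ≤ p x + p y)
    (hsmul : ∀ (a : ℝ) (x : X), p (a • x) = |a| * p x) {t : ℝ} {x y : X}
    (hx : p x ≤ 1) (hy : p y ≤ 1) (ht : t ≤ p (x - y)) :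
    modulusOfConvexityFor p t ≤ 1 - p ((2:ℝ)⁻¹ • (x + y)) := by
  refine csInf_le ⟨0, ?_⟩ ⟨x, y, hx, hy, ht, rfl⟩
  rintro r ⟨u, v, hu, hv, -, rfl⟩
  rw [hsmul, abs_of_pos (by norm_num)]
  linarith [hadd u v]

theorem modulusOfConvexityFor_le_half (hadd : ∀ x y : X, p (x + y) ≤ p x + p y)
    (hsmul : ∀ (a : ℝ) (x : X), p (a • x) = |a| * p x) {x : X} (hx : 0 < p x)
    {s : ℝ} (hs : 0 ≤ s) (hs1 : s ≤ 1) : modulusOfConvexityFor p s ≤ s / 2 := by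
  have hscale : ∀ c : ℝ, 0 ≤ c → p (c • (p x)⁻¹ • x) = c := fun c hc => by
    rw [hsmul, hsmul, abs_of_nonneg hc, abs_of_pos (inv_pos.2 hx), inv_mul_cancel₀ hx.ne',
      mul_one]
  have hdiff : (1:ℝ) • (p x)⁻¹ • x - (1 - s) • (p x)⁻¹ • x = s • (p x)⁻¹ • x := by module
  have hmid : (2:ℝ)⁻¹ • ((1:ℝ) • (p x)⁻¹ • x + (1 - s) • (p x)⁻¹ • x)
      = (1 - s / 2) • (p x)⁻¹ • x := by module
  have h := modulusOfConvexityFor_le hadd hsmul (t := s) (x := (1:ℝ) • (p x)⁻¹ • x)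
    (y := (1 - s) • (p x)⁻¹ • x) (hscale 1 zero_le_one).le
    (by rw [hscale _ (by linarith)]; linarith) (by rw [hdiff, hscale s hs])
  rw [hmid, hscale _ (by linarith)] at h
  linarith

theorem map_midpoint_le_sub_modulusOfConvexityFor
    (hadd : ∀ x y : X, p (x + y) ≤ p x + p y)
    (hsmul : ∀ (a : ℝ) (x : X), p (a • x) = |a| * p x) {r s : ℝ} (hr : 0 < r) {x y : X}
    (hx : p x ≤ r) (hy : p y ≤ r) (hs : s ≤ p (x - y)) :
    p ((2:ℝ)⁻¹ • (x + y)) ≤ r - r * modulusOfConvexityFor p (s / r) := by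
  have hscale : ∀ z : X, p (r⁻¹ • z) = p z / r := fun z => by
    rw [hsmul, abs_of_pos (inv_pos.2 hr), inv_mul_eq_div]
  have h := modulusOfConvexityFor_le hadd hsmul (t := s / r) (x := r⁻¹ • x) (y := r⁻¹ • y)
    (by rw [hscale]; exact (div_le_one hr).2 hx) (by rw [hscale]; exact (div_le_one hr).2 hy)
    (by rw [← smul_sub, hscale]; gcongr)
  rw [← smul_add, smul_comm, hscale] at h
  have h' := mul_le_mul_of_nonneg_left h hr.le
  rw [mul_sub, mul_div_cancel₀ _ hr.ne'] at h'
  linarith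

/-- The midpoint estimate for the sum of two norms on its unit ball, for ordered `p₁`-norms. -/
theorem sum_of_norms_midpoint_le_of_le {p₁ p₂ : X → ℝ}
    (hadd₁ : ∀ x y : X, p₁ (x + y) ≤ p₁ x + p₁ y)
    (hsmul₁ : ∀ (a : ℝ) (x : X), p₁ (a • x) = |a| * p₁ x)
    (hadd₂ : ∀ x y : X, p₂ (x + y) ≤ p₂ x + p₂ y)
    (hsmul₂ : ∀ (a : ℝ) (x : X), p₂ (a • x) = |a| * p₂ x)
    (hle : ∀ x : X, p₂ x ≤ p₁ x)
    (hmono : ∀ s t : ℝ, 0 < s → s ≤ t → t ≤ 2 →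
      modulusOfConvexityFor p₁ s / s ≤ modulusOfConvexityFor p₁ t / t)
    {t : ℝ} (ht : 0 < t) (ht1 : t < 1) {x y : X} (hx : p₁ x + p₂ x ≤ 1)
    (hy : p₁ y + p₂ y ≤ 1) (hxy : t ≤ p₁ (x - y) + p₂ (x - y)) (hyx : p₁ y ≤ p₁ x) :
    p₁ ((2:ℝ)⁻¹ • (x + y)) + p₂ ((2:ℝ)⁻¹ • (x + y)) ≤
      1 - modulusOfConvexityFor p₁ (t / 4) := by
  have hnn₁ := nonneg_of_add_le_of_smul hadd₁ hsmul₁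
  have hnn₂ := nonneg_of_add_le_of_smul hadd₂ hsmul₂
  have hneg₁ : ∀ z, p₁ (-z) = p₁ z := fun z => by simpa using hsmul₁ (-1) z
  have hneg₂ : ∀ z, p₂ (-z) = p₂ z := fun z => by simpa using hsmul₂ (-1) z
  have htri₁ := hadd₁ x (-y)
  have htri₂ := hadd₂ x (-y)
  rw [← sub_eq_add_neg, hneg₁] at htri₁
  rw [← sub_eq_add_neg, hneg₂] at htri₂
  have hxpos : 0 < p₁ x := by linarith [hle x, hle y]
  have hhalf : |(2:ℝ)⁻¹| = 2⁻¹ := abs_of_pos (by norm_num)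
  have hmid₁ := hadd₁ x y
  have hmid₂ : p₂ ((2:ℝ)⁻¹ • (x + y)) ≤ (p₂ x + p₂ y) / 2 := by
    rw [hsmul₂, hhalf]
    linarith [hadd₂ x y]
  by_cases hslack : p₁ x + p₂ x + (p₁ y + p₂ y) ≤ 2 - t / 4
  · have := modulusOfConvexityFor_le_half hadd₁ hsmul₁ hxpos (s := t / 4)
      (by linarith) (by linarith)
    rw [hsmul₁, hhalf]
    linarith
  push Not at hslack
  have hb : 3 / 8 ≤ p₁ y := by linarith [hle y]
  have hb1 : p₁ y ≤ 1 := by linarith [hnn₂ y]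
  -- Rescale `x` so that it has the same `p₁`-norm as `y`.
  set c : ℝ := p₁ y / p₁ x
  have hc0 : 0 ≤ c := div_nonneg (hnn₁ y) hxpos.le
  have hc1 : c ≤ 1 := (div_le_one hxpos).2 hyx
  have hcx : c * p₁ x = p₁ y := div_mul_cancel₀ _ hxpos.ne'
  have hx' : p₁ (c • x) = p₁ y := by rw [hsmul₁, abs_of_nonneg hc0, hcx]
  have hx'₂ : p₂ (c • x) = c * p₂ x := by rw [hsmul₂, abs_of_nonneg hc0]
  have hrest : |1 - c| = 1 - c := abs_of_nonneg (by linarith)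
  have hdist : t / 4 ≤ p₁ (c • x - y) := by
    have hsplit : x - y = (c • x - y) + (1 - c) • x := by module
    have h₁ := hadd₁ (c • x - y) ((1 - c) • x)
    have h₂ := hadd₂ (c • x - y) ((1 - c) • x)
    rw [← hsplit, hsmul₁, hrest] at h₁
    rw [← hsplit, hsmul₂, hrest] at h₂
    have hsplit' : y = c • x + -(c • x - y) := by abel
    have h₃ := hadd₂ (c • x) (-(c • x - y))
    rw [← hsplit', hneg₂, hx'₂] at h₃
    linarith [hle (c • x - y)]
  have hconv := map_midpoint_le_sub_modulusOfConvexityFor hadd₁ hsmul₁ (by linarith)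
    hx'.le le_rfl hdist
  have hbpos : 0 < p₁ y := by linarith
  have hδ : modulusOfConvexityFor p₁ (t / 4) ≤
      p₁ y * modulusOfConvexityFor p₁ (t / 4 / p₁ y) := by
    have h := hmono (t / 4) (t / 4 / p₁ y) (by linarith)
      (le_div_self (by linarith) hbpos hb1) (by rw [div_le_iff₀ hbpos]; linarith)
    have h' := mul_le_mul_of_nonneg_left h (by linarith : 0 ≤ t / 4)
    rw [mul_div_cancel₀ _ (by linarith : t / 4 ≠ 0)] at h'
    refine h'.trans_eq ?_
    field_simp
  have hmid : (2:ℝ)⁻¹ • (x + y) = (2:ℝ)⁻¹ • (c • x + y) + ((1 - c) / 2) • x := by module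
  have h₁ := hadd₁ ((2:ℝ)⁻¹ • (c • x + y)) (((1 - c) / 2) • x)
  rw [← hmid, hsmul₁ _ x, abs_of_nonneg (by linarith : 0 ≤ (1 - c) / 2)] at h₁
  linarith

end AbstractNorm

/-- Lemma on the sum of two norms. If `p₂ ≤ p₁` are norms on `X` and `δ₁` is
the modulus of convexity of `(X, p₁)` (which is non-decreasing, as is `t ↦ δ₁(t)/t`), then the
norm `‖x‖ = p₁(x) + p₂(x)` satisfies `‖(x+y)/2‖ ≤ 1 - δ₁(t/4)` whenever `‖x‖ = ‖y‖ = 1` and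
`‖x - y‖ ≥ t`, `t ∈ (0,1)`; hence its modulus of convexity satisfies `δ(t) ≥ δ₁(t/4)`. -/
theorem sum_of_norms_modulus {X : Type*} [AddCommGroup X] [Module ℝ X] (p₁ p₂ : X → ℝ)
    (hp₁_add : ∀ x y : X, p₁ (x + y) ≤ p₁ x + p₁ y)
    (hp₁_smul : ∀ (a : ℝ) (x : X), p₁ (a • x) = |a| * p₁ x)
    (hp₁_zero : ∀ x : X, p₁ x = 0 ↔ x = 0)
    (hp₂_add : ∀ x y : X, p₂ (x + y) ≤ p₂ x + p₂ y)
    (hp₂_smul : ∀ (a : ℝ) (x : X), p₂ (a • x) = |a| * p₂ x)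
    (hp₂_zero : ∀ x : X, p₂ x = 0 ↔ x = 0)
    (hle : ∀ x : X, p₂ x ≤ p₁ x)
    (hmono : ∀ s t : ℝ, 0 < s → s ≤ t → t ≤ 2 →
      modulusOfConvexityFor p₁ s ≤ modulusOfConvexityFor p₁ t)
    (hmono' : ∀ s t : ℝ, 0 < s → s ≤ t → t ≤ 2 →
      modulusOfConvexityFor p₁ s / s ≤ modulusOfConvexityFor p₁ t / t) :
    ∀ t ∈ Set.Ioo (0:ℝ) 1,
      (∀ x y : X, p₁ x + p₂ x = 1 → p₁ y + p₂ y = 1 → t ≤ p₁ (x - y) + p₂ (x - y) →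
        p₁ ((2:ℝ)⁻¹ • (x + y)) + p₂ ((2:ℝ)⁻¹ • (x + y))
          ≤ 1 - modulusOfConvexityFor p₁ (t / 4)) ∧
      modulusOfConvexityFor p₁ (t / 4)
        ≤ modulusOfConvexityFor (fun x => p₁ x + p₂ x) t := by
  intro t ht
  obtain ⟨ht0, ht1⟩ := ht
  have key : ∀ x y : X, p₁ x + p₂ x ≤ 1 → p₁ y + p₂ y ≤ 1 → t ≤ p₁ (x - y) + p₂ (x - y) →
      p₁ ((2:ℝ)⁻¹ • (x + y)) + p₂ ((2:ℝ)⁻¹ • (x + y))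
        ≤ 1 - modulusOfConvexityFor p₁ (t / 4) := by
    intro x y hx hy hxy
    rcases le_total (p₁ y) (p₁ x) with h | h
    · exact sum_of_norms_midpoint_le_of_le hp₁_add hp₁_smul hp₂_add hp₂_smul hle hmono'
        ht0 ht1 hx hy hxy h
    · have hneg₁ : p₁ (y - x) = p₁ (x - y) := by simpa using hp₁_smul (-1) (x - y)
      have hneg₂ : p₂ (y - x) = p₂ (x - y) := by simpa using hp₂_smul (-1) (x - y)
      rw [add_comm x y]
      exact sum_of_norms_midpoint_le_of_le hp₁_add hp₁_smul hp₂_add hp₂_smul hle hmono'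
        ht0 ht1 hy hx (by rwa [hneg₁, hneg₂]) h
  refine ⟨fun x y hx hy hxy => key x y hx.le hy.le hxy, ?_⟩
  by_cases hX : ∀ x : X, x = 0
  · have hp : ∀ x, p₁ x = 0 := fun x => (hp₁_zero x).2 (hX x)
    have hp' : ∀ x, p₂ x = 0 := fun x => (hp₂_zero x).2 (hX x)
    have ht4 : ¬ t / 4 ≤ 0 := by linarith
    simp [modulusOfConvexityFor, hp, hp', not_le.2 ht0, ht4]
  · push Not at hX
    obtain ⟨z, hz⟩ := hX
    have hzpos : 0 < p₁ z := (nonneg_of_add_le_of_smul hp₁_add hp₁_smul z).lt_of_ne'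
      (mt (hp₁_zero z).1 hz)
    have hNpos : 0 < p₁ z + p₂ z := by
      linarith [nonneg_of_add_le_of_smul hp₂_add hp₂_smul z]
    have hscale : ∀ c : ℝ, p₁ (c • (p₁ z + p₂ z)⁻¹ • z) + p₂ (c • (p₁ z + p₂ z)⁻¹ • z) = |c| := by
      intro c
      rw [hp₁_smul, hp₁_smul, hp₂_smul, hp₂_smul, abs_of_pos (inv_pos.2 hNpos)]
      field_simp
    refine le_csInf ⟨_, (1:ℝ) • (p₁ z + p₂ z)⁻¹ • z, (-1:ℝ) • (p₁ z + p₂ z)⁻¹ • z, ?_, ?_, ?_,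
      rfl⟩ ?_
    · exact (hscale 1).le.trans (by norm_num)
    · exact (hscale (-1)).le.trans (by norm_num)
    · rw [← sub_smul]
      exact le_trans (by norm_num; linarith) (hscale (1 - -1)).ge
    · rintro r ⟨x, y, hx, hy, hxy, rfl⟩
      linarith [key x y hx hy hxy]

end
end

section
/- Let 2 < p < ∞ and let μ be a positive measure such that the real Banach space L_p(μ) has dimension at least 2 (i.e., contains two linearly independent elements). Then L_p(μ) is not a universal pointwise BPB domain space: there exists a Banach space Y such that the pair (L_p(μ), Y) fails the pointwise Bishop–Phelps–Bollobás property. -/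
open scoped Topology ENNReal
open Filter Metric

noncomputable section

theorem sq_cross_le (z y : ℂ) {R : ℝ} (hR : ‖y‖ ≤ R) :
    (z.re * y.im - z.im * y.re) ^ 2 ≤
      (‖y‖ * ‖z‖ - (z.re * y.re + z.im * y.im)) * (2 * (R * ‖z‖)) := by
  have hz : ‖z‖ ^ 2 = z.re ^ 2 + z.im ^ 2 := by rw [Complex.sq_norm, Complex.normSq_apply]; ring
  have hy : ‖y‖ ^ 2 = y.re ^ 2 + y.im ^ 2 := by rw [Complex.sq_norm, Complex.normSq_apply]; ring
  have h : (‖y‖ * ‖z‖) ^ 2 =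
      (z.re * y.re + z.im * y.im) ^ 2 + (z.re * y.im - z.im * y.re) ^ 2 := by
    rw [mul_pow, hz, hy]; ring
  have hcs : z.re * y.re + z.im * y.im ≤ ‖y‖ * ‖z‖ :=
    le_of_sq_le_sq (by nlinarith) (by positivity)
  have hRz : ‖y‖ * ‖z‖ ≤ R * ‖z‖ := by gcongr
  nlinarith

/-- The Euclidean norm of the plane has a quadratic lower bound for its second differences. -/
theorem sq_mul_sq_cross_le (z w : ℂ) {t : ℝ} (ht : 0 < t) (ht1 : t ≤ 1) :
    t ^ 2 * (z.re * w.im - z.im * w.re) ^ 2 ≤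
      (‖z + t • w‖ + ‖z - t • w‖ - 2 * ‖z‖) * ((‖z‖ + ‖w‖) * ‖z‖) * ‖z‖ := by
  have htw : ‖t • w‖ ≤ ‖w‖ := by
    rw [norm_smul, Real.norm_of_nonneg ht.le]
    exact mul_le_of_le_one_left (norm_nonneg _) ht1
  have h1 := sq_cross_le z (z + t • w) (R := ‖z‖ + ‖w‖) ((norm_add_le _ _).trans (by linarith))
  have h2 := sq_cross_le z (z - t • w) (R := ‖z‖ + ‖w‖) ((norm_sub_le _ _).trans (by linarith))
  simp only [Complex.add_re, Complex.add_im, Complex.sub_re, Complex.sub_im, Complex.smul_re,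
    Complex.smul_im, smul_eq_mul] at h1 h2
  have hz : ‖z‖ * ‖z‖ = z.re ^ 2 + z.im ^ 2 := by
    rw [Complex.norm_mul_self_eq_normSq, Complex.normSq_apply]; ring
  have h3 : (‖z + t • w‖ + ‖z - t • w‖ - 2 * ‖z‖) * ((‖z‖ + ‖w‖) * ‖z‖) * ‖z‖ =
      (‖z + t • w‖ * ‖z‖ + ‖z - t • w‖ * ‖z‖ - 2 * (‖z‖ * ‖z‖)) * ((‖z‖ + ‖w‖) * ‖z‖) := by ring
  rw [h3, hz]
  nlinarith

open Complex in
/-- The weighted `ℓ₁`-sum of the sup norm and the Euclidean norm on the plane admits no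
nondegenerate pair `a, b` whose second differences at `a` vanish to order `q > 2`. -/
theorem cross_eq_zero_of_norm_le {c q : ℝ} (hc : 0 < c) (hq : 2 < q) (a b : ℝ × ℝ)
    (ha : ‖a‖ + c * ‖equivRealProdCLM.symm a‖ = 1)
    (h : ∀ t : ℝ, |t| ≤ 1 →
      ‖a + t • b‖ + c * ‖equivRealProdCLM.symm (a + t • b)‖ ≤ 1 + |t| ^ q) :
    a.1 * b.2 - a.2 * b.1 = 0 := by
  set z := equivRealProdCLM.symm a with hz
  set w := equivRealProdCLM.symm b with hw
  set D := a.1 * b.2 - a.2 * b.1 with hD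
  set K := ((‖z‖ + ‖w‖) * ‖z‖) * ‖z‖
  have hK : 0 ≤ K := by positivity
  have hbound : ∀ t : ℝ, 0 < t → t ≤ 1 → c * D ^ 2 ≤ 2 * K * t ^ (q - 2) := by
    intro t ht ht1
    have e1 := h t (by rwa [abs_of_pos ht])
    have e2 := h (-t) (by rwa [abs_neg, abs_of_pos ht])
    rw [abs_neg] at e2
    simp only [abs_of_pos ht, map_add, map_smul, neg_smul, ← sub_eq_add_neg, map_sub] at e1 e2
    rw [← hz, ← hw] at e1 e2
    have e3 : 2 * ‖a‖ ≤ ‖a + t • b‖ + ‖a - t • b‖ := by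
      have := norm_add_le (a + t • b) (a - t • b)
      rwa [add_add_sub_cancel, ← two_smul ℝ, norm_smul, Real.norm_two] at this
    have e4 : t ^ 2 * D ^ 2 ≤ (‖z + t • w‖ + ‖z - t • w‖ - 2 * ‖z‖) * K := by
      have := sq_mul_sq_cross_le z w ht ht1
      rw [mul_assoc] at this
      exact this
    have e5 : c * (‖z + t • w‖ + ‖z - t • w‖ - 2 * ‖z‖) ≤ 2 * t ^ q := by linarith
    have e6 : t ^ q = t ^ 2 * t ^ (q - 2) := by
      rw [← Real.rpow_natCast, ← Real.rpow_add ht]; norm_num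
    have e7 : t ^ 2 * (c * D ^ 2) ≤ t ^ 2 * (2 * K * t ^ (q - 2)) := by
      have := mul_le_mul_of_nonneg_right e5 hK
      rw [e6] at this
      nlinarith
    exact le_of_mul_le_mul_left e7 (by positivity)
  have hlim : Tendsto (fun t : ℝ => 2 * K * t ^ (q - 2)) (𝓝[>] 0) (𝓝 0) := by
    have : ContinuousAt (fun t : ℝ => 2 * K * t ^ (q - 2)) 0 :=
      (Real.continuousAt_rpow_const _ _ (Or.inr (by linarith))).const_mul _
    have h0 : 2 * K * (0 : ℝ) ^ (q - 2) = 0 := by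
      rw [Real.zero_rpow (by linarith), mul_zero]
    have := this.tendsto
    rw [h0] at this
    exact this.mono_left nhdsWithin_le_nhds
  have hle : c * D ^ 2 ≤ 0 := by
    refine ge_of_tendsto hlim ?_
    filter_upwards [Ioc_mem_nhdsGT (zero_lt_one' ℝ)] with t ht
    exact hbound t ht.1 ht.2
  have : D ^ 2 ≤ 0 := nonpos_of_mul_nonpos_right hle hc
  exact pow_eq_zero_iff two_ne_zero |>.1 (le_antisymm this (sq_nonneg _))

/-- The map `a ↦ (a, c a)` from the plane with the sup norm into the `ℓ₁`-sum of the plane with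
the sup norm and the Euclidean plane. -/
def graphMap (c : ℝ) : ℝ × ℝ →ₗ[ℝ] WithLp 1 ((ℝ × ℝ) × ℂ) :=
  (WithLp.linearEquiv 1 ℝ ((ℝ × ℝ) × ℂ)).symm.toLinearMap ∘ₗ
    LinearMap.prod LinearMap.id (c • Complex.equivRealProdCLM.symm.toLinearMap)

/-- The plane with the norm `‖a‖_∞ + |c| ‖a‖_2`. -/
abbrev Plane (c : ℝ) : Type := LinearMap.range (graphMap c)

instance (c : ℝ) : CompleteSpace (Plane c) := FiniteDimensional.complete ℝ _

theorem norm_plane {c : ℝ} (hc : 0 ≤ c) (y : Plane c) :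
    ‖y‖ = ‖y.1.fst‖ + c * ‖Complex.equivRealProdCLM.symm y.1.fst‖ := by
  obtain ⟨_, a, rfl⟩ := y
  rw [Submodule.coe_norm, WithLp.prod_norm_eq_of_L1]
  change ‖a‖ + ‖c • Complex.equivRealProdCLM.symm a‖ = _
  rw [norm_smul, Real.norm_of_nonneg hc]
  rfl

theorem norm_equivRealProd_symm_le (a : ℝ × ℝ) :
    ‖Complex.equivRealProdCLM.symm a‖ ≤ 2 * ‖a‖ := by
  have h := Complex.norm_le_abs_re_add_abs_im (Complex.equivRealProdCLM.symm a)
  have h1 := norm_fst_le a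
  have h2 := norm_snd_le a
  simp only [Real.norm_eq_abs] at h1 h2
  simp only [Complex.equivRealProdCLM_symm_apply_re,
    Complex.equivRealProdCLM_symm_apply_im] at h
  linarith

/-- The planes with the norms `‖a‖_∞ + ‖a‖_2 / (n + 1)`, in an `ℓ_∞`-sum. -/
abbrev PlaneSum : Type := lp (fun n : ℕ => Plane (1 / ((n : ℝ) + 1))) ∞

theorem eq_zero_of_norm_add_smul_le {X : Type*} [NormedAddCommGroup X] [NormedSpace ℝ X]
    {u v : X} {q : ℝ} (hq : 1 < q) {φ : StrongDual ℝ X} (hφ : ‖φ‖ ≤ 1) (hφu : φ u = 1)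
    (huv : ∀ t : ℝ, |t| ≤ 1 → ‖u + t • v‖ ≤ 1 + |t| ^ q) : φ v = 0 := by
  have hle : ∀ s : ℝ, |s| = 1 → s * φ v ≤ 0 := by
    intro s hs
    have hlim : Tendsto (fun t : ℝ => t ^ (q - 1)) (𝓝[>] 0) (𝓝 0) := by
      have := (Real.continuousAt_rpow_const 0 (q - 1) (Or.inr (by linarith))).tendsto
      rw [Real.zero_rpow (by linarith)] at this
      exact this.mono_left nhdsWithin_le_nhds
    refine ge_of_tendsto hlim ?_
    filter_upwards [Ioc_mem_nhdsGT (zero_lt_one' ℝ)] with t ht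
    have hts : |t * s| = t := by rw [abs_mul, hs, mul_one, abs_of_pos ht.1]
    have h1 := (le_abs_self _).trans (φ.le_of_opNorm_le hφ (u + (t * s) • v))
    have h2 := huv (t * s) (by rw [hts]; exact ht.2)
    rw [map_add, map_smul, hφu, smul_eq_mul] at h1
    have h3 : t * (s * φ v) ≤ t * t ^ (q - 1) := by
      rw [hts] at h2
      have : t * t ^ (q - 1) = t ^ q := by
        rw [← Real.rpow_one_add' ht.1.le (by linarith)]; congr 1; ring
      linarith
    exact le_of_mul_le_mul_left h3 ht.1
  have h1 := hle 1 (by simp)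
  have h2 := hle (-1) (by simp)
  linarith

theorem cross_pos {a b : ℝ × ℝ} {r y : ℝ} (hr : 1 / 3 ≤ r) (hr1 : r ≤ 1) (hy : |y| ≤ 1)
    (ha : ‖a - r • ((1 : ℝ), y)‖ < 1 / 20) (hb : ‖b - r • ((0 : ℝ), (1 : ℝ))‖ < 1 / 20) :
    0 < a.1 * b.2 - a.2 * b.1 := by
  rw [Prod.norm_def, max_lt_iff] at ha hb
  simp only [Prod.fst_sub, Prod.snd_sub, Prod.smul_mk, smul_eq_mul, Real.norm_eq_abs, abs_lt,
    mul_one, mul_zero, sub_zero] at ha hb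
  obtain ⟨⟨ha1, -⟩, ha2, ha2'⟩ := ha
  obtain ⟨⟨hb1, hb1'⟩, hb2, -⟩ := hb
  rw [abs_le] at hy
  have hprod : (1 / 3 - 1 / 20) * (1 / 3 - 1 / 20) ≤ a.1 * b.2 :=
    mul_le_mul (by linarith) (by linarith) (by norm_num) (by linarith)
  have habs : |a.2 * b.1| ≤ (1 + 1 / 20) * (1 / 20) := by
    rw [abs_mul]
    refine mul_le_mul (abs_le.2 ⟨?_, ?_⟩) (abs_le.2 ⟨?_, ?_⟩) (abs_nonneg _) (by norm_num) <;>
      nlinarith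
  have := (abs_le.1 habs).2
  norm_num at hprod this
  linarith

theorem not_ptwiseBPB_planeSum {X : Type*} [NormedAddCommGroup X] [NormedSpace ℝ X]
    {u v : X} {q : ℝ} (hq : 2 < q) (hu : ‖u‖ = 1) (hv : ‖v‖ = 1)
    (huv : ∀ t : ℝ, |t| ≤ 1 → ‖u + t • v‖ ≤ 1 + |t| ^ q) :
    ¬ PtwiseBPB ℝ X PlaneSum := by
  intro hBPB
  obtain ⟨η, hη, hBPB⟩ := hBPB (1 / 20) (by norm_num)
  obtain ⟨φ, hφ, hφu⟩ := exists_dual_vector'' ℝ u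
  obtain ⟨ψ, hψ, hψv⟩ := exists_dual_vector'' ℝ v
  rw [hu] at hφu
  rw [hv] at hψv
  simp only [RCLike.ofReal_real_eq_id, id_eq] at hφu hψv
  have hφv : φ v = 0 := eq_zero_of_norm_add_smul_le (by linarith) hφ hφu huv
  obtain ⟨n, hn⟩ := exists_nat_one_div_lt (half_pos hη)
  set c : ℝ := 1 / ((n : ℝ) + 1) with hc
  have hc0 : 0 < c := by positivity
  have hc1 : c ≤ 1 := by
    rw [hc, div_le_one (by positivity)]
    linarith [n.cast_nonneg (α := ℝ)]
  set T : X →L[ℝ] PlaneSum :=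
    (lp.singleContinuousLinearMap ℝ (fun n : ℕ => Plane (1 / ((n : ℝ) + 1))) ∞ n) ∘L
      (graphMap c).rangeRestrict.toContinuousLinearMap ∘L φ.prod ψ with hT
  have hTn : ∀ x, (T x n).1.fst = (φ x, ψ x) := by
    intro x
    have : T x n = (graphMap c).rangeRestrict (φ x, ψ x) := lp.single_apply_self ..
    rw [this]
    rfl
  have hTk : ∀ x k, k ≠ n → T x k = 0 := fun x k hk => lp.single_apply_ne _ _ _ hk
  have hnormT : ∀ x, ‖T x‖ = ‖(φ x, ψ x)‖ + c * ‖Complex.equivRealProdCLM.symm (φ x, ψ x)‖ := by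
    intro x
    rw [← hTn, ← norm_plane hc0.le]
    have : T x = lp.single ∞ n (T x n) := by
      ext k
      by_cases hk : k = n
      · subst hk; rw [lp.single_apply_self]
      · rw [hTk x k hk, lp.single_apply_ne _ _ _ hk]
    conv_lhs => rw [this]
    exact lp.norm_single (by simp) _ _
  have hTle : ‖T‖ ≤ 1 + 2 * c := by
    refine T.opNorm_le_bound (by positivity) fun x => ?_
    have h1 : ‖(φ x, ψ x)‖ ≤ ‖x‖ := by
      rw [Prod.norm_mk]
      exact max_le (φ.le_of_opNorm_le hφ x |>.trans_eq (one_mul _))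
        (ψ.le_of_opNorm_le hψ x |>.trans_eq (one_mul _))
    have h2 := norm_equivRealProd_symm_le (φ x, ψ x)
    rw [hnormT]
    nlinarith
  have hTu : 1 ≤ ‖T u‖ := by
    rw [hnormT]
    have h1 : ‖φ u‖ ≤ ‖(φ u, ψ u)‖ := norm_fst_le (φ u, ψ u)
    rw [hφu] at h1 ⊢
    have h2 : 0 ≤ c * ‖Complex.equivRealProdCLM.symm ((1 : ℝ), ψ u)‖ := by positivity
    rw [norm_one] at h1
    linarith
  have hTge : 1 ≤ ‖T‖ := hTu.trans (T.le_opNorm u |>.trans_eq (by rw [hu, mul_one]))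
  set r := ‖T‖⁻¹ with hr
  have hr0 : 0 < r := by positivity
  have hr1 : r ≤ 1 := inv_le_one_of_one_le₀ hTge
  have hr3 : 1 / 3 ≤ r := by
    rw [hr, ← one_div]
    exact one_div_le_one_div_of_le (by linarith) (by linarith)
  have hrc : 1 - 2 * c ≤ r := by
    have h1 : r * ‖T‖ = 1 := inv_mul_cancel₀ (by linarith)
    nlinarith
  obtain ⟨S, hS, hSu, hST⟩ := hBPB (r • T) u
    (by rw [norm_smul, Real.norm_of_nonneg hr0.le, inv_mul_cancel₀ (by linarith)]) hu
    (by
      rw [_root_.smul_apply, norm_smul, Real.norm_of_nonneg hr0.le]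
      nlinarith)
  have hdiff : ∀ x, ‖x‖ = 1 → ∀ k, ‖S x k - r • T x k‖ < 1 / 20 := by
    intro x hx k
    refine (lp.norm_apply_le_norm ENNReal.top_ne_zero ((S - r • T) x) k).trans_lt ?_
    exact ((S - r • T).le_opNorm x).trans_lt (by rwa [hx, mul_one])
  set a := (S u n).1.fst with ha
  set b := (S v n).1.fst with hb
  have hSun : ‖S u n‖ = 1 := by
    refine le_antisymm ((lp.norm_apply_le_norm ENNReal.top_ne_zero _ n).trans_eq hSu) ?_
    by_contra! hlt
    have : ‖S u‖ ≤ max (1 / 20) ‖S u n‖ := by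
      refine lp.norm_le_of_forall_le (by positivity) fun k => ?_
      by_cases hk : k = n
      · subst hk; exact le_max_right _ _
      · have := hdiff u hu k
        rw [hTk u k hk, smul_zero, sub_zero] at this
        exact this.le.trans (le_max_left _ _)
    rw [hSu] at this
    rcases le_max_iff.1 this with h | h <;> linarith
  have hcross : a.1 * b.2 - a.2 * b.1 = 0 := by
    refine cross_eq_zero_of_norm_le hc0 hq a b ?_ fun t ht => ?_
    · rw [ha, ← norm_plane hc0.le, hSun]
    · have hfst : a + t • b = (S (u + t • v) n).1.fst := by
        rw [map_add, map_smul]; rfl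
      rw [hfst, ← norm_plane hc0.le]
      refine (lp.norm_apply_le_norm ENNReal.top_ne_zero _ n).trans ?_
      refine (S.le_opNorm _).trans ?_
      rw [hS, one_mul]
      exact huv t ht
  have hfst : ∀ x, ‖x‖ = 1 → ‖(S x n).1.fst - r • (φ x, ψ x)‖ < 1 / 20 := by
    intro x hx
    refine lt_of_le_of_lt ?_ (hdiff x hx n)
    rw [← hTn x, norm_plane hc0.le]
    exact le_add_of_nonneg_right (by positivity)
  have hau := hfst u hu
  have hbv := hfst v hv
  rw [← ha, hφu] at hau
  rw [← hb, hφv, hψv] at hbv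
  have hψu : |ψ u| ≤ 1 := by
    have := ψ.le_of_opNorm_le hψ u
    rwa [hu, mul_one] at this
  exact (cross_pos hr3 hr1 hψu hau hbv).ne' hcross

section DisjointSupport

open MeasureTheory

variable {α : Type*} [MeasurableSpace α] {μ : Measure α} {p : ℝ≥0∞}

theorem norm_rpow_add_of_disjoint [Fact (1 ≤ p)] (hp' : p ≠ ∞) {u v : Lp ℝ p μ}
    (h : ∀ᵐ x ∂μ, u x = 0 ∨ v x = 0) :
    ‖u + v‖ ^ p.toReal = ‖u‖ ^ p.toReal + ‖v‖ ^ p.toReal := by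
  have hp0 : p ≠ 0 := (zero_lt_one.trans_le (Fact.out : 1 ≤ p)).ne'
  have hpos : 0 < p.toReal := ENNReal.toReal_pos hp0 hp'
  have hnorm : ∀ w : Lp ℝ p μ, ‖w‖ₑ ^ p.toReal = ∫⁻ x, ‖w x‖ₑ ^ p.toReal ∂μ := by
    intro w
    rw [Lp.enorm_def, eLpNorm_eq_lintegral_rpow_enorm_toReal hp0 hp', ← ENNReal.rpow_mul,
      one_div_mul_cancel hpos.ne', ENNReal.rpow_one]
  have he : ‖u + v‖ₑ ^ p.toReal = ‖u‖ₑ ^ p.toReal + ‖v‖ₑ ^ p.toReal := by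
    rw [hnorm, hnorm, hnorm, ← lintegral_add_left' ((Lp.aestronglyMeasurable u).enorm.pow_const _)]
    refine lintegral_congr_ae ?_
    filter_upwards [h, Lp.coeFn_add u v] with x hx hadd
    rw [hadd, Pi.add_apply]
    rcases hx with hx | hx <;> simp [hx, ENNReal.zero_rpow_of_pos hpos]
  have := congrArg ENNReal.toReal he
  rwa [ENNReal.toReal_add (by finiteness) (by finiteness), ← ENNReal.toReal_rpow,
    ← ENNReal.toReal_rpow, ← ENNReal.toReal_rpow, toReal_enorm, toReal_enorm, toReal_enorm] at this

theorem exists_posPart_negPart_ne_zero [Fact (1 ≤ p)]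
    (hdim : ∃ f g : Lp ℝ p μ, LinearIndependent ℝ ![f, g]) :
    ∃ h : Lp ℝ p μ, Lp.posPart h ≠ 0 ∧ Lp.negPart h ≠ 0 := by
  obtain ⟨f, g, hfg⟩ := hdim
  by_contra! hcon
  have hrank : 1 < Module.rank ℝ (Lp ℝ p μ) := by
    have := hfg.cardinal_lift_le_rank
    simp only [Cardinal.mk_fin, Cardinal.lift_natCast, Cardinal.lift_id'] at this
    refine lt_of_lt_of_le ?_ (by simpa using this)
    exact_mod_cast one_lt_two
  have hconn := (isConnected_compl_singleton_of_one_lt_rank hrank (0 : Lp ℝ p μ)).isPreconnected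
  have hf : f ≠ 0 := hfg.ne_zero 0
  have hzero : ∀ h : Lp ℝ p μ, Lp.posPart h = 0 → Lp.negPart h = 0 → h = 0 := by
    intro h hpos hneg
    have e1 := Lp.coeFn_posPart h
    have e2 := Lp.coeFn_negPart_eq_max h
    rw [hpos] at e1
    rw [hneg] at e2
    rw [Lp.eq_zero_iff_ae_eq_zero]
    filter_upwards [e1, e2, Lp.coeFn_zero ℝ p μ] with x h1 h2 h0
    rw [h0, Pi.zero_apply] at h1 h2
    exact le_antisymm (max_eq_right_iff.1 h1.symm)
      (neg_nonpos.1 (max_eq_right_iff.1 h2.symm))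
  have hcases : ∀ h : Lp ℝ p μ, Lp.posPart h = 0 ∨ Lp.negPart h = 0 :=
    fun h => or_iff_not_imp_left.2 (hcon h)
  have hsplit := isPreconnected_closed_iff.1 hconn {h | Lp.posPart h = 0} {h | Lp.negPart h = 0}
    (isClosed_eq Lp.continuous_posPart continuous_const)
    (isClosed_eq Lp.continuous_negPart continuous_const) (fun h _ => hcases h)
  have hnegneg : Lp.negPart (-f) = Lp.posPart f := by rw [Lp.negPart, neg_neg]
  obtain ⟨h, hne, h1, h2⟩ :
      ({0}ᶜ ∩ ({h | Lp.posPart h = 0} ∩ {h : Lp ℝ p μ | Lp.negPart h = 0})).Nonempty := by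
    rcases hcases f with hc | hc
    · exact hsplit ⟨f, hf, hc⟩ ⟨-f, neg_ne_zero.2 hf, hnegneg.trans hc⟩
    · exact hsplit ⟨-f, neg_ne_zero.2 hf, hc⟩ ⟨f, hf, hc⟩
  exact hne (hzero h h1 h2)

theorem exists_unit_pair_norm_add_smul_le [Fact (1 ≤ p)] (hp' : p ≠ ∞)
    (hdim : ∃ f g : Lp ℝ p μ, LinearIndependent ℝ ![f, g]) :
    ∃ u v : Lp ℝ p μ, ‖u‖ = 1 ∧ ‖v‖ = 1 ∧ ∀ t : ℝ, ‖u + t • v‖ ≤ 1 + |t| ^ p.toReal := by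
  obtain ⟨h, hpos, hneg⟩ := exists_posPart_negPart_ne_zero hdim
  have hp1 : 1 ≤ p.toReal := by
    simpa using ENNReal.toReal_mono hp' (Fact.out : 1 ≤ p)
  have hnorm : ∀ w : Lp ℝ p μ, w ≠ 0 → ‖‖w‖⁻¹ • w‖ = 1 := fun w hw => by
    rw [norm_smul, norm_inv, norm_norm, inv_mul_cancel₀ (norm_ne_zero_iff.2 hw)]
  refine ⟨‖Lp.posPart h‖⁻¹ • Lp.posPart h, ‖Lp.negPart h‖⁻¹ • Lp.negPart h, hnorm _ hpos,
    hnorm _ hneg, fun t => ?_⟩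
  have hdisj : ∀ a b : ℝ, ∀ᵐ x ∂μ,
      (a • Lp.posPart h : Lp ℝ p μ) x = 0 ∨ (b • Lp.negPart h : Lp ℝ p μ) x = 0 := by
    intro a b
    filter_upwards [Lp.coeFn_posPart h, Lp.coeFn_negPart_eq_max h,
      Lp.coeFn_smul a (Lp.posPart h), Lp.coeFn_smul b (Lp.negPart h)] with x h1 h2 h3 h4
    rw [h3, h4, Pi.smul_apply, Pi.smul_apply, h1, h2]
    rcases le_total (h x) 0 with hx | hx
    · left; simp [hx]
    · right; simp [hx]
  have key := norm_rpow_add_of_disjoint hp' (hdisj ‖Lp.posPart h‖⁻¹ (t * ‖Lp.negPart h‖⁻¹))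
  rw [mul_smul, norm_smul t, hnorm _ hpos, hnorm _ hneg, mul_one, Real.norm_eq_abs,
    Real.one_rpow] at key
  set s := ‖‖Lp.posPart h‖⁻¹ • Lp.posPart h + t • ‖Lp.negPart h‖⁻¹ • Lp.negPart h‖
  have ht : 0 ≤ |t| ^ p.toReal := by positivity
  by_contra! hs
  have := Real.self_le_rpow_of_one_le (by linarith : 1 ≤ s) hp1
  linarith

end DisjointSupport

open MeasureTheory in
/-- For `2 < p < ∞`, a real space `L_p(μ)` of dimension at least `2` is not
a universal pointwise BPB domain space. -/
theorem Lp_not_universal_domain {α : Type*} [MeasurableSpace α] (μ : Measure α)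
    (p : ℝ≥0∞) [Fact (1 ≤ p)] (hp : 2 < p) (hp' : p ≠ ∞)
    (hdim : ∃ f g : Lp ℝ p μ, LinearIndependent ℝ ![f, g]) :
    ∃ (Y : Type) (_ : NormedAddCommGroup Y) (_ : NormedSpace ℝ Y) (_ : CompleteSpace Y),
      ¬ PtwiseBPB ℝ (Lp ℝ p μ) Y := by
  obtain ⟨u, v, hu, hv, huv⟩ := exists_unit_pair_norm_add_smul_le hp' hdim
  have hq : 2 < p.toReal := by
    simpa using (ENNReal.toReal_lt_toReal ENNReal.ofNat_ne_top hp').2 hp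
  exact ⟨PlaneSum, inferInstance, inferInstance, inferInstance,
    not_ptwiseBPB_planeSum hq hu hv fun t _ => huv t⟩

end
end

section
/- Let Y be a Banach space of dimension at least 2 which is simultaneously uniformly convex and uniformly smooth. Then Y is not a universal pointwise BPB range space: there exists a uniformly smooth Banach space X such that the pair (X, Y) fails the pointwise Bishop–Phelps–Bollobás property. -/
open scoped Topology ENNReal
open Filter Metric

noncomputable section

section Smoothness

theorem bddAbove_modulusOfSmoothness (E : Type*) [NormedAddCommGroup E] (t : ℝ) :
    BddAbove {r : ℝ | ∃ x y : E, ‖x‖ = 1 ∧ ‖y‖ ≤ t ∧ r = (‖x + y‖ + ‖x - y‖ - 2) / 2} := by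
  refine ⟨t, ?_⟩
  rintro r ⟨x, y, hx, hy, rfl⟩
  linarith [norm_add_le x y, norm_sub_le x y]

theorem UniformlySmooth.exists_norm_add_norm_sub_le {E : Type*} [NormedAddCommGroup E]
    (h : UniformlySmooth E) {ε : ℝ} (hε : 0 < ε) :
    ∃ δ > 0, ∀ x y : E, ‖x‖ = 1 → ‖y‖ ≤ δ → ‖x + y‖ + ‖x - y‖ ≤ 2 + ε * ‖y‖ := by
  have h1 := h.eventually (gt_mem_nhds (half_pos hε))
  obtain ⟨δ, hδ, H⟩ := (mem_nhdsGT_iff_exists_Ioo_subset).1 h1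
  have hδ : (0 : ℝ) < δ := hδ
  refine ⟨δ / 2, half_pos hδ, fun x y hx hy => ?_⟩
  rcases eq_or_ne y 0 with rfl | hy0
  · simp only [add_zero, sub_zero, norm_zero, mul_zero]; linarith
  have hpos : 0 < ‖y‖ := norm_pos_iff.2 hy0
  have h2 : modulusOfSmoothness E ‖y‖ / ‖y‖ < ε / 2 := H ⟨hpos, by linarith⟩
  rw [div_lt_iff₀ hpos] at h2
  have h3 := le_csSup (bddAbove_modulusOfSmoothness E ‖y‖) ⟨x, y, hx, le_rfl, rfl⟩
  change _ ≤ modulusOfSmoothness E ‖y‖ at h3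
  linarith

theorem uniformlySmooth_of_norm_sq_le {E : Type*} [NormedAddCommGroup E]
    (h : ∀ ε > 0, ∃ C : ℝ, 0 ≤ C ∧ ∀ x y : E,
      ‖x + y‖ ^ 2 + ‖x - y‖ ^ 2 ≤ 2 * ‖x‖ ^ 2 + ε * (‖x‖ * ‖y‖) + C * ‖y‖ ^ 2) :
    UniformlySmooth E := by
  refine Metric.tendsto_nhdsWithin_nhds.2 fun ε hε => ?_
  obtain ⟨C, hC, H⟩ := h ε hε
  refine ⟨ε / (C + 1), by positivity, fun {t} ht htd => ?_⟩
  have ht : (0 : ℝ) < t := ht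
  rw [Real.dist_eq, sub_zero, abs_of_pos ht, lt_div_iff₀ (by positivity)] at htd
  have hnonneg : 0 ≤ modulusOfSmoothness E t := by
    by_cases hE : ∃ x : E, ‖x‖ = 1
    · obtain ⟨x, hx⟩ := hE
      exact le_csSup (bddAbove_modulusOfSmoothness E t)
        ⟨x, 0, hx, by simpa using ht.le, by norm_num [hx]⟩
    · refine Real.sSup_nonneg ?_
      rintro r ⟨x, -, hx, -⟩
      exact absurd ⟨x, hx⟩ hE
  have hle : modulusOfSmoothness E t ≤ (ε * t + C * t ^ 2) / 4 := by
    refine Real.sSup_le ?_ (by positivity)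
    rintro r ⟨x, y, hx, hy, rfl⟩
    have h1 := H x y
    rw [hx] at h1
    have h2 : ε * (1 * ‖y‖) ≤ ε * t := by rw [one_mul]; gcongr
    have h3 : C * ‖y‖ ^ 2 ≤ C * t ^ 2 := by gcongr
    have h4 : (‖x + y‖ + ‖x - y‖) ^ 2 ≤ 4 + 2 * (ε * t + C * t ^ 2) := by
      nlinarith [sq_nonneg (‖x + y‖ - ‖x - y‖)]
    nlinarith [sq_nonneg (‖x + y‖ + ‖x - y‖ - 2)]
  rw [Real.dist_eq, sub_zero, abs_of_nonneg (by positivity), div_lt_iff₀ ht]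
  nlinarith

theorem norm_sq_add_norm_sq_le {E : Type*} [NormedAddCommGroup E]
    (𝕜 : Type*) [RCLike 𝕜] [NormedSpace 𝕜 E] {ε δ : ℝ} (hε : 0 < ε) (hδ : 0 < δ)
    (h : ∀ x y : E, ‖x‖ = 1 → ‖y‖ ≤ δ → ‖x + y‖ + ‖x - y‖ ≤ 2 + ε * ‖y‖) (x y : E) :
    ‖x + y‖ ^ 2 + ‖x - y‖ ^ 2 ≤
      2 * ‖x‖ ^ 2 + 2 * ε * (‖x‖ * ‖y‖) + (2 + ε ^ 2 + 4 / δ) * ‖y‖ ^ 2 := by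
  have ha := norm_add_le x y
  have hb := norm_sub_le x y
  have hx0 := norm_nonneg x
  have hy0 := norm_nonneg y
  have hxy : 0 ≤ ‖x‖ * ‖y‖ := by positivity
  have hCy : 0 ≤ 4 / δ * ‖y‖ ^ 2 := by positivity
  by_cases hle : ‖y‖ ≤ δ * ‖x‖
  · rcases eq_or_ne x 0 with rfl | hx
    · have : y = 0 := by simpa using hle
      simp [this]
    have hxpos : 0 < ‖x‖ := norm_pos_iff.2 hx
    have hsum : ‖x + y‖ + ‖x - y‖ ≤ 2 * ‖x‖ + ε * ‖y‖ := by
      set a : 𝕜 := ((‖x‖⁻¹ : ℝ) : 𝕜)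
      have hna : ‖a‖ = ‖x‖⁻¹ := by simp [a]
      have := h (a • x) (a • y) (by rw [norm_smul, hna, inv_mul_cancel₀ hxpos.ne'])
        (by rw [norm_smul, hna, inv_mul_le_iff₀ hxpos]; linarith)
      rw [← smul_add, ← smul_sub, norm_smul, norm_smul, norm_smul, hna] at this
      have := mul_le_mul_of_nonneg_left this hx0
      field_simp at this
      linarith
    have hd : |‖x + y‖ - ‖x - y‖| ≤ 2 * ‖y‖ := by
      refine (abs_norm_sub_norm_le _ _).trans ?_
      rw [show x + y - (x - y) = y + y by abel]
      linarith [norm_add_le y y]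
    have hd2 : (‖x + y‖ - ‖x - y‖) ^ 2 ≤ (2 * ‖y‖) ^ 2 := sq_le_sq' (abs_le.1 hd).1 (abs_le.1 hd).2
    have hs2 : (‖x + y‖ + ‖x - y‖) ^ 2 ≤ (2 * ‖x‖ + ε * ‖y‖) ^ 2 := by gcongr
    nlinarith [mul_nonneg (sq_nonneg ε) (sq_nonneg ‖y‖)]
  · push Not at hle
    have h1 : ‖x + y‖ ^ 2 ≤ (‖x‖ + ‖y‖) ^ 2 := by gcongr
    have h2 : ‖x - y‖ ^ 2 ≤ (‖x‖ + ‖y‖) ^ 2 := by gcongr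
    have h3 : 4 * (‖x‖ * ‖y‖) ≤ 4 / δ * ‖y‖ ^ 2 := by
      rw [div_mul_eq_mul_div, le_div_iff₀ hδ]
      nlinarith
    nlinarith [mul_nonneg hε.le hxy, mul_nonneg (sq_nonneg ε) (sq_nonneg ‖y‖)]

theorem lp_two_hasSum_norm_sq {ι : Type*} {E : ι → Type*} [∀ i, NormedAddCommGroup (E i)]
    (f : lp E 2) : HasSum (fun i => ‖f i‖ ^ 2) (‖f‖ ^ 2) := by
  simpa using lp.hasSum_norm (p := 2) (by simp) f

theorem uniformlySmooth_lp_two {ι : Type*} {E : ι → Type*} [∀ i, NormedAddCommGroup (E i)]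
    (h : ∀ ε > 0, ∃ C : ℝ, 0 ≤ C ∧ ∀ i, ∀ x y : E i,
      ‖x + y‖ ^ 2 + ‖x - y‖ ^ 2 ≤ 2 * ‖x‖ ^ 2 + ε * (‖x‖ * ‖y‖) + C * ‖y‖ ^ 2) :
    UniformlySmooth (lp E 2) := by
  refine uniformlySmooth_of_norm_sq_le fun ε hε => ?_
  obtain ⟨C, hC, H⟩ := h ε hε
  refine ⟨C, hC, fun x y => ?_⟩
  have hpq : (2 : ℝ≥0∞).toReal.HolderConjugate (2 : ℝ≥0∞).toReal := by
    simpa using Real.HolderConjugate.two_two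
  obtain ⟨hs, hxy⟩ := lp.tsum_mul_le_mul_norm hpq x y
  have h1 := (lp_two_hasSum_norm_sq (x + y)).add (lp_two_hasSum_norm_sq (x - y))
  have h2 := (((lp_two_hasSum_norm_sq x).mul_left 2).add (hs.hasSum.mul_left ε)).add
    ((lp_two_hasSum_norm_sq y).mul_left C)
  have h3 := hasSum_le (fun i => H i (x i) (y i)) h1 h2
  have := mul_le_mul_of_nonneg_left hxy hε.le
  linarith

end Smoothness

section Thickening

variable (𝕜 : Type*) [RCLike 𝕜] {Y : Type*} [NormedAddCommGroup Y] [NormedSpace 𝕜 Y]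

theorem exists_forall_norm_add_smul_le {𝕜 W : Type*} [RCLike 𝕜] [NormedAddCommGroup W]
    [NormedSpace 𝕜 W] (a : W) {b : W} (hb : b ≠ 0) :
    ∃ z : 𝕜, ∀ z' : 𝕜, ‖a + z • b‖ ≤ ‖a + z' • b‖ := by
  refine Continuous.exists_forall_le (f := fun z : 𝕜 => ‖a + z • b‖) (by fun_prop) ?_
  have h1 : Tendsto (fun z : 𝕜 => ‖z‖ * ‖b‖ - ‖a‖) (cocompact 𝕜) atTop :=
    tendsto_atTop_add_const_right _ _
      ((tendsto_norm_cocompact_atTop (E := 𝕜)).atTop_mul_const (norm_pos_iff.2 hb))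
  refine tendsto_atTop_mono (fun z => ?_) h1
  have := norm_sub_le (a + z • b) a
  rw [add_sub_cancel_left, norm_smul] at this
  linarith

/-- The map `(y, c) ↦ y + c • w`. -/
def addLine (w : Y) : Y × 𝕜 →L[𝕜] Y :=
  (ContinuousLinearMap.id 𝕜 Y).coprod (ContinuousLinearMap.toSpanSingleton 𝕜 w)

variable {𝕜} in
@[simp] theorem addLine_apply (w : Y) (p : Y × 𝕜) : addLine 𝕜 w p = p.1 + p.2 • w := by
  simp [addLine]

instance (w : Y) : IsClosed ((addLine 𝕜 w).ker : Set (Y × 𝕜)) := (addLine 𝕜 w).isClosed_ker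

/-- The space `Y` renormed so that its closed unit ball is `{y + c • w | ‖y‖ ≤ 1, ‖c‖ ≤ 1}`. -/
abbrev Thickening (w : Y) : Type _ := (Y × 𝕜) ⧸ (addLine 𝕜 w).ker

namespace Thickening

variable {𝕜} {w : Y}

/-- The class of `y + c • w`. -/
def mk (w : Y) : Y × 𝕜 →ₗ[𝕜] Thickening 𝕜 w := (addLine 𝕜 w).ker.mkQ

theorem mk_eq_mk {p q : Y × 𝕜} : mk w p = mk w q ↔ addLine 𝕜 w p = addLine 𝕜 w q := by
  simp only [mk, Submodule.mkQ_apply, Submodule.Quotient.eq, LinearMap.mem_ker]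
  rw [map_sub, sub_eq_zero]
  rfl

theorem norm_mk_le (p : Y × 𝕜) : ‖mk w p‖ ≤ ‖p‖ := Submodule.Quotient.norm_mk_le _ p

theorem exists_rep (x : Thickening 𝕜 w) : ∃ p : Y × 𝕜, mk w p = x ∧ ‖p‖ = ‖x‖ := by
  obtain ⟨p, rfl⟩ := Submodule.mkQ_surjective _ x
  change ∃ p' : Y × 𝕜, mk w p' = mk w p ∧ ‖p'‖ = ‖mk w p‖
  obtain ⟨z, hz⟩ := exists_forall_norm_add_smul_le (𝕜 := 𝕜) p (b := (w, (-1 : 𝕜))) (by simp)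
  have hzp : mk w (p + z • (w, (-1 : 𝕜))) = mk w p := by
    rw [mk_eq_mk]; simp [add_smul]; abel
  refine ⟨_, hzp, le_antisymm ?_ (by rw [← hzp]; exact norm_mk_le _)⟩
  refine le_of_forall_pos_le_add fun ε hε => ?_
  obtain ⟨q, hq, hqn⟩ : ∃ q, mk w q = mk w p ∧ ‖q‖ < ‖mk w p‖ + ε :=
    Submodule.Quotient.norm_mk_lt _ hε
  have hq' : addLine 𝕜 w q = addLine 𝕜 w p := mk_eq_mk.1 hq
  have : q = p + (p.2 - q.2) • (w, (-1 : 𝕜)) := by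
    rw [addLine_apply, addLine_apply] at hq'
    ext
    · change q.1 = p.1 + (p.2 - q.2) • w
      rw [eq_sub_of_add_eq hq', sub_smul]; abel
    · simp
  have h1 := hz (p.2 - q.2)
  rw [← this] at h1
  linarith

/-- The identity from the renormed space to `Y`. -/
def toBase (w : Y) : Thickening 𝕜 w →L[𝕜] Y :=
  LinearMap.mkContinuous ((addLine 𝕜 w).ker.liftQ (addLine 𝕜 w : Y × 𝕜 →ₗ[𝕜] Y) le_rfl) (1 + ‖w‖)
    fun x => by
      obtain ⟨p, rfl, hp⟩ := exists_rep x
      change ‖addLine 𝕜 w p‖ ≤ _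
      rw [← hp, addLine_apply]
      have h1 := norm_fst_le p
      have h2 := norm_snd_le p
      have h3 : ‖p.2‖ * ‖w‖ ≤ ‖p‖ * ‖w‖ := by gcongr
      have := norm_add_le p.1 (p.2 • w)
      rw [norm_smul] at this
      linarith

theorem norm_toBase_le : ‖toBase (𝕜 := 𝕜) w‖ ≤ 1 + ‖w‖ :=
  LinearMap.mkContinuous_norm_le _ (by positivity) _

@[simp] theorem toBase_mk (p : Y × 𝕜) : toBase w (mk w p) = p.1 + p.2 • w := addLine_apply w p

theorem mk_eq (p : Y × 𝕜) : mk w p = mk w (p.1 + p.2 • w, 0) := by simp [mk_eq_mk]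

theorem one_le_norm_add (hw : ‖w‖ < 1) {F : Thickening 𝕜 w →L[𝕜] 𝕜} (hF : ‖F‖ ≤ 1)
    {p : Y × 𝕜} (hc : ‖p.2‖ ≤ 1) (hFp : F (mk w p) = 1) {k : Y}
    (hk : RCLike.re (F (mk w (k, 0))) = 0) : 1 ≤ ‖p.1 + k‖ := by
  by_contra! hlt
  have hFle : ∀ q, ‖F (mk w q)‖ ≤ ‖q‖ := fun q =>
    (F.le_of_opNorm_le hF _).trans (by rw [one_mul]; exact norm_mk_le q)
  set m := ‖p.1 + k‖
  set g := RCLike.re (F (mk w (p.1 + k, 0)))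
  set l := RCLike.re (F (mk w (0, p.2)))
  have hgl : g + l = 1 := by
    have : F (mk w (p.1 + k, 0)) + F (mk w (0, p.2)) = 1 + F (mk w (k, 0)) := by
      rw [← hFp, ← map_add F, ← map_add F, ← map_add (mk w), ← map_add (mk w)]
      simp only [Prod.mk_add_mk, add_zero, zero_add]
      congr 2
      ext <;> simp
    have := congrArg RCLike.re this
    simpa [hk] using this
  have h1 : g + m * l ≤ m := by
    have h2 : F (mk w (p.1 + k, (m : 𝕜) * p.2)) =
        F (mk w (p.1 + k, 0)) + (m : 𝕜) * F (mk w (0, p.2)) := by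
      rw [← smul_eq_mul (m : 𝕜) (F _), ← map_smul, ← map_smul, ← map_add, ← map_add]
      simp
    have h3 := (RCLike.re_le_norm _).trans (hFle (p.1 + k, (m : 𝕜) * p.2))
    rw [h2, map_add, RCLike.re_ofReal_mul] at h3
    refine h3.trans (max_le le_rfl ?_)
    simp only [norm_mul, RCLike.norm_ofReal]
    rw [abs_of_nonneg (norm_nonneg _)]
    exact mul_le_of_le_one_right (norm_nonneg _) hc
  have h4 : l ≤ ‖w‖ := by
    have h5 := (RCLike.re_le_norm _).trans (hFle (p.2 • w, 0))
    have h6 : mk w ((0 : Y), p.2) = mk w (p.2 • w, 0) := by simp [mk_eq_mk]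
    change RCLike.re (F (mk w (0, p.2))) ≤ _
    rw [h6]
    refine h5.trans (max_le ?_ (by simp))
    simpa [norm_smul] using mul_le_of_le_one_left (norm_nonneg w) hc
  nlinarith

theorem norm_add_norm_sub_le (hw : ‖w‖ < 1) {ε δ : ℝ} (hε : 0 < ε)
    (h : ∀ x y : Y, ‖x‖ = 1 → ‖y‖ ≤ δ → ‖x + y‖ + ‖x - y‖ ≤ 2 + ε * ‖y‖)
    (x t : Thickening 𝕜 w) (hx : ‖x‖ = 1) (ht : ‖t‖ ≤ min (δ / 8) (1 / 2)) :
    ‖x + t‖ + ‖x - t‖ ≤ 2 + 8 * ε * ‖t‖ := by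
  obtain ⟨htδ, ht2⟩ := le_min_iff.1 ht
  obtain ⟨F, hF, hFx⟩ := exists_dual_vector'' 𝕜 x
  obtain ⟨p, rfl, hp⟩ := exists_rep x
  rw [hx, RCLike.ofReal_one] at hFx
  have hc : ‖p.2‖ ≤ 1 := (norm_snd_le p).trans (by rw [hp, hx])
  have hy : ‖p.1‖ = 1 := le_antisymm ((norm_fst_le p).trans (by rw [hp, hx]))
    (by
      have h0 : RCLike.re (F (mk w ((0 : Y), (0 : 𝕜)))) = 0 := by
        rw [Prod.mk_zero_zero, map_zero, map_zero, map_zero]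
      simpa using one_le_norm_add hw hF hc hFx h0)
  -- a perturbation along the kernel of `re F` is controlled by the smoothness of `Y`
  have key : ∀ (a : ℝ) (k : Y), 1 / 2 ≤ a → ‖k‖ ≤ δ / 2 → RCLike.re (F (mk w (k, 0))) = 0 →
      ‖(a : 𝕜) • mk w p + mk w (k, 0)‖ ≤ a + ε * ‖k‖ := by
    intro a k ha hk hFk
    have ha0 : 0 < a := by linarith
    have hak : ‖((a⁻¹ : ℝ) : 𝕜) • k‖ = a⁻¹ * ‖k‖ := by
      rw [norm_smul, RCLike.norm_ofReal, abs_of_pos (by positivity)]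
    have h1 := h p.1 (((a⁻¹ : ℝ) : 𝕜) • k) hy (by
      rw [hak, inv_mul_le_iff₀ ha0]; nlinarith [norm_nonneg k])
    have h2 := one_le_norm_add hw hF hc hFx (k := -(((a⁻¹ : ℝ) : 𝕜) • k)) (by
      have : mk w (-(((a⁻¹ : ℝ) : 𝕜) • k), (0 : 𝕜)) = (((-a⁻¹ : ℝ) : 𝕜)) • mk w (k, 0) := by
        rw [← map_smul]; simp
      rw [this, map_smul, smul_eq_mul, RCLike.re_ofReal_mul, hFk, mul_zero])
    rw [← sub_eq_add_neg] at h2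
    have h3 : ‖p.1 + ((a⁻¹ : ℝ) : 𝕜) • k‖ ≤ 1 + ε * (a⁻¹ * ‖k‖) := by rw [← hak]; linarith
    rw [← map_smul, ← map_add]
    refine (norm_mk_le _).trans (max_le ?_ ?_)
    · have : ((a : 𝕜) • p + (k, 0)).1 = (a : 𝕜) • (p.1 + ((a⁻¹ : ℝ) : 𝕜) • k) := by
        rw [smul_add, smul_smul, ← RCLike.ofReal_mul, mul_inv_cancel₀ ha0.ne']
        simp
      rw [this, norm_smul, RCLike.norm_ofReal, abs_of_pos ha0]
      calc a * _ ≤ a * (1 + ε * (a⁻¹ * ‖k‖)) := by gcongr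
        _ = a + ε * ‖k‖ := by field_simp
    · have : ((a : 𝕜) • p + (k, 0)).2 = (a : 𝕜) * p.2 := by simp
      rw [this, norm_mul, RCLike.norm_ofReal, abs_of_pos ha0]
      nlinarith [norm_nonneg k]
  set s : ℝ := RCLike.re (F t)
  have hs : |s| ≤ ‖t‖ := by
    refine (RCLike.abs_re_le_norm _).trans ((F.le_of_opNorm_le hF t).trans (one_mul _).le)
  obtain ⟨q, hq, hqn⟩ := exists_rep (t - (s : 𝕜) • mk w p)
  have hqt : ‖q‖ ≤ 2 * ‖t‖ := by
    rw [hqn]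
    refine (norm_sub_le _ _).trans ?_
    rw [norm_smul, hx, RCLike.norm_ofReal]
    linarith
  set k := q.1 + q.2 • w
  have hk : ‖k‖ ≤ 4 * ‖t‖ := by
    have h1 := norm_add_le q.1 (q.2 • w)
    rw [norm_smul] at h1
    have h2 : ‖q.2‖ * ‖w‖ ≤ ‖q.2‖ := mul_le_of_le_one_right (norm_nonneg _) hw.le
    linarith [norm_fst_le q, norm_snd_le q]
  have hmk : mk w (k, 0) = t - (s : 𝕜) • mk w p := by rw [← hq, mk_eq q]
  have hFk : RCLike.re (F (mk w (k, 0))) = 0 := by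
    rw [hmk, map_sub, map_smul, hFx]; simp [s]
  have hmkneg : mk w (-k, (0 : 𝕜)) = -mk w (k, 0) := by rw [← map_neg]; simp
  have h1 := key (1 + s) k (by linarith [neg_abs_le s]) (by linarith) hFk
  have h2 := key (1 - s) (-k) (by linarith [le_abs_self s]) (by rw [norm_neg]; linarith)
    (by rw [hmkneg, map_neg, map_neg, hFk, neg_zero])
  have e1 : ((1 + s : ℝ) : 𝕜) • mk w p + mk w (k, 0) = mk w p + t := by
    rw [hmk, RCLike.ofReal_add, add_smul, RCLike.ofReal_one, one_smul]; abel
  have e2 : ((1 - s : ℝ) : 𝕜) • mk w p + mk w (-k, 0) = mk w p - t := by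
    rw [hmkneg, hmk, RCLike.ofReal_sub, sub_smul, RCLike.ofReal_one, one_smul]; abel
  rw [e1] at h1
  rw [e2, norm_neg] at h2
  have : ε * ‖k‖ ≤ ε * (4 * ‖t‖) := by gcongr
  linarith

end Thickening

end Thickening

/-- The `i`-th coordinate projection of an `ℓ²`-sum. -/
def lpTwoProj (𝕜 : Type*) [RCLike 𝕜] {ι : Type*} (E : ι → Type*)
    [∀ i, NormedAddCommGroup (E i)] [∀ i, NormedSpace 𝕜 (E i)] (i : ι) : lp E 2 →L[𝕜] E i :=
  LinearMap.mkContinuous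
    { toFun := fun f => f i
      map_add' := fun _ _ => rfl
      map_smul' := fun _ _ => rfl } 1 fun f => by
    rw [one_mul]
    exact lp.norm_apply_le_norm two_ne_zero f i

theorem norm_lpTwoProj_le {𝕜 : Type*} [RCLike 𝕜] {ι : Type*} {E : ι → Type*}
    [∀ i, NormedAddCommGroup (E i)] [∀ i, NormedSpace 𝕜 (E i)] (i : ι) :
    ‖lpTwoProj 𝕜 E i‖ ≤ 1 :=
  LinearMap.mkContinuous_norm_le _ zero_le_one _

theorem exists_birkhoff_orthogonal {𝕜 Y : Type*} [RCLike 𝕜] [NormedAddCommGroup Y]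
    [NormedSpace 𝕜 Y] (hdim : ∃ y₁ y₂ : Y, LinearIndependent 𝕜 ![y₁, y₂]) :
    ∃ y v : Y, ‖y‖ = 1 ∧ ‖v‖ = 1 ∧ ∀ z : 𝕜, 1 ≤ ‖y + z • v‖ := by
  obtain ⟨a, b, hab⟩ := hdim
  rw [LinearIndependent.pair_iff] at hab
  have hb : b ≠ 0 := fun h => one_ne_zero (hab 0 1 (by simp [h])).2
  obtain ⟨z₀, hz₀⟩ := exists_forall_norm_add_smul_le (𝕜 := 𝕜) a hb
  set u := a + z₀ • b
  have hu : u ≠ 0 := fun h => one_ne_zero (hab 1 z₀ (by rw [one_smul]; exact h)).1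
  have hu' : 0 < ‖u‖ := norm_pos_iff.2 hu
  refine ⟨((‖u‖⁻¹ : ℝ) : 𝕜) • u, ((‖b‖⁻¹ : ℝ) : 𝕜) • b, ?_, ?_, fun z => ?_⟩
  · rw [norm_smul]; simp [hu]
  · rw [norm_smul]; simp [hb]
  · have h1 := hz₀ (z₀ + (‖u‖ : 𝕜) * z * ((‖b‖⁻¹ : ℝ) : 𝕜))
    have h2 : ((‖u‖⁻¹ : ℝ) : 𝕜) • u + z • ((‖b‖⁻¹ : ℝ) : 𝕜) • b =
        ((‖u‖⁻¹ : ℝ) : 𝕜) • (a + (z₀ + (‖u‖ : 𝕜) * z * ((‖b‖⁻¹ : ℝ) : 𝕜)) • b) := by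
      have h3 : ((‖u‖⁻¹ : ℝ) : 𝕜) * (‖u‖ : 𝕜) = 1 := by
        rw [← RCLike.ofReal_mul, inv_mul_cancel₀ hu'.ne', RCLike.ofReal_one]
      rw [add_smul, ← add_assoc, smul_add _ (a + z₀ • b), smul_smul, smul_smul, ← mul_assoc,
        ← mul_assoc, h3, one_mul]
    rw [h2, norm_smul, RCLike.norm_ofReal, abs_of_pos (by positivity), inv_mul_eq_div,
      one_le_div hu']
    exact h1

theorem eq_zero_of_norm_add_le_of_norm_sub_le {Y : Type*} [NormedAddCommGroup Y]
    [UniformConvexSpace Y] {𝕜 : Type*} [RCLike 𝕜] [NormedSpace 𝕜 Y] {a b : Y} (ha : ‖a‖ = 1)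
    (h₁ : ‖a + b‖ ≤ 1) (h₂ : ‖a - b‖ ≤ 1) : b = 0 := by
  by_contra hb
  have two : ∀ c : Y, ‖c + c‖ = 2 * ‖c‖ := fun c => by
    rw [← two_smul 𝕜 c, norm_smul, RCLike.norm_ofNat]
  have hsum : ‖a + b + (a - b)‖ = 2 := by
    rw [show a + b + (a - b) = a + a by abel, two, ha, mul_one]
  have htri := norm_add_le (a + b) (a - b)
  have hpos : 0 < ‖a + b - (a - b)‖ := by
    rw [show a + b - (a - b) = b + b by abel, two]
    have := norm_pos_iff.2 hb
    positivity
  obtain ⟨δ, hδ, H⟩ := UniformConvexSpace.uniform_convex (E := Y) hpos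
  have := H (x := a + b) (by linarith) (y := a - b) (by linarith) le_rfl
  linarith

/-- A Banach space of dimension at least `2` which is simultaneously
uniformly convex and uniformly smooth is not a universal pointwise BPB range space. -/
theorem uniformly_convex_smooth_not_universal_range {𝕜 : Type} [RCLike 𝕜]
    (Y : Type) [NormedAddCommGroup Y] [NormedSpace 𝕜 Y] [CompleteSpace Y]
    (hdim : ∃ y₁ y₂ : Y, LinearIndependent 𝕜 ![y₁, y₂])
    (hconv : UniformConvexSpace Y) (hsmooth : UniformlySmooth Y) :
    ∃ (X : Type) (_ : NormedAddCommGroup X) (_ : NormedSpace 𝕜 X) (_ : CompleteSpace X),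
      UniformlySmooth X ∧ ¬ PtwiseBPB 𝕜 X Y := by
  obtain ⟨y, v, hy, hv, hyv⟩ := exists_birkhoff_orthogonal hdim
  set r : ℕ → ℝ := fun n => 1 / ((n : ℝ) + 2)
  have hr0 : ∀ n, 0 < r n := fun n => by positivity
  have hr1 : ∀ n, r n < 1 := fun n => by
    rw [div_lt_one (by positivity)]; linarith [(Nat.cast_nonneg n : (0 : ℝ) ≤ n)]
  set w : ℕ → Y := fun n => (r n : 𝕜) • v
  have hw : ∀ n, ‖w n‖ = r n := fun n => by
    simp only [w]
    rw [norm_smul, hv, mul_one, RCLike.norm_ofReal, abs_of_pos (hr0 n)]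
  refine ⟨lp (fun n => Thickening 𝕜 (w n)) 2, inferInstance, inferInstance, inferInstance, ?_, ?_⟩
  · refine uniformlySmooth_lp_two fun ε hε => ?_
    obtain ⟨δ, hδ, H⟩ := hsmooth.exists_norm_add_norm_sub_le (show 0 < ε / 16 by positivity)
    have hδ' : 0 < min (δ / 8) (1 / 2) := by positivity
    refine ⟨2 + (8 * (ε / 16)) ^ 2 + 4 / min (δ / 8) (1 / 2), by positivity, fun n x t => ?_⟩
    have := norm_sq_add_norm_sq_le 𝕜 (show 0 < 8 * (ε / 16) by positivity) hδ'
      (Thickening.norm_add_norm_sub_le (by rw [hw]; exact hr1 n) (by positivity) H) x t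
    convert this using 3
    ring
  · intro hB
    obtain ⟨η, hη, H⟩ := hB (1 / 2) (by norm_num)
    obtain ⟨n, hn⟩ := exists_nat_one_div_lt hη
    have hrn : r n < η := lt_of_le_of_lt (by simp only [r]; gcongr; norm_num) hn
    let E : ℕ → Type := fun n => Thickening 𝕜 (w n)
    let ι : Thickening 𝕜 (w n) →ₗ[𝕜] lp E 2 := lp.lsingle (E := E) 2 n
    have hι : ∀ x, ‖ι x‖ = ‖x‖ := fun x => lp.norm_single (E := E) (p := 2) (by simp) n x
    let J : lp E 2 →L[𝕜] Y := (Thickening.toBase (w n)).comp (lpTwoProj 𝕜 E n)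
    have hJ : ∀ p : Y × 𝕜, J (ι (Thickening.mk (w n) p)) = p.1 + p.2 • w n := fun p => by
      change Thickening.toBase (w n) (lp.single (E := E) 2 n (Thickening.mk (w n) p) n) = _
      rw [lp.single_apply_self, Thickening.toBase_mk]
    have hJle : ‖J‖ ≤ 1 + r n := by
      refine (ContinuousLinearMap.opNorm_comp_le _ _).trans ?_
      rw [← hw n, ← mul_one (1 + ‖w n‖)]
      exact mul_le_mul Thickening.norm_toBase_le (norm_lpTwoProj_le n) (norm_nonneg _)
        (by positivity)
    set x₀ := ι (Thickening.mk (w n) (y, 0))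
    set u := ι (Thickening.mk (w n) (v, 0))
    have hx₀ : ‖x₀‖ = 1 := by
      rw [hι]
      refine le_antisymm ((Thickening.norm_mk_le _).trans (by simp [hy])) ?_
      obtain ⟨p, hp, hpn⟩ := Thickening.exists_rep (Thickening.mk (w n) (y, (0 : 𝕜)))
      rw [Thickening.mk_eq_mk, addLine_apply, addLine_apply, zero_smul, add_zero] at hp
      have h1 := hyv (-(p.2 * (r n : 𝕜)))
      rw [neg_smul, mul_smul, ← sub_eq_add_neg, ← eq_sub_of_add_eq hp] at h1
      rw [← hpn]
      exact h1.trans (norm_fst_le p)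
    have hJx₀ : J x₀ = y := by simp [x₀, hJ]
    have hJu : J u = v := by simp [u, hJ]
    have hu : ‖u‖ ≤ 1 := by
      rw [hι]
      exact (Thickening.norm_mk_le _).trans (by simp [hv])
    have hJge : 1 ≤ ‖J‖ := by
      have := J.le_opNorm x₀
      rwa [hJx₀, hy, hx₀, mul_one] at this
    have hJpos : 0 < ‖J‖ := by linarith
    have hinv : ‖((‖J‖⁻¹ : ℝ) : 𝕜)‖ = ‖J‖⁻¹ := by
      rw [RCLike.norm_ofReal, abs_of_pos (inv_pos.2 hJpos)]
    obtain ⟨S, hS, hSx₀, hST⟩ := H (((‖J‖⁻¹ : ℝ) : 𝕜) • J) x₀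
      (by rw [norm_smul, hinv, inv_mul_cancel₀ hJpos.ne']) hx₀ (by
        rw [smul_apply, norm_smul, hinv, hJx₀, hy, mul_one,
          ← one_div, lt_div_iff₀ hJpos]
        nlinarith [hr0 n, mul_pos (sub_pos.2 hrn) hJpos])
    have hseg : ∀ c : 𝕜, ‖c‖ ≤ 1 → ‖S x₀ + c • (r n : 𝕜) • S u‖ ≤ 1 := fun c hc => by
      have h1 : x₀ + c • (r n : 𝕜) • u = ι (Thickening.mk (w n) (y, c)) := by
        simp only [x₀, u, ← map_smul, ← map_add]
        congr 1
        rw [Thickening.mk_eq_mk]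
        simp [w]
      rw [← map_smul, ← map_smul, ← map_add, h1]
      refine (S.le_of_opNorm_le hS.le _).trans ?_
      rw [one_mul, hι]
      exact (Thickening.norm_mk_le _).trans (max_le hy.le hc)
    have hSu : S u = 0 := by
      have h1 := hseg 1 (by simp)
      have h2 := hseg (-1) (by simp)
      rw [one_smul] at h1
      rw [neg_one_smul, ← sub_eq_add_neg] at h2
      have := eq_zero_of_norm_add_le_of_norm_sub_le (𝕜 := 𝕜) hSx₀ h1 h2
      refine (smul_eq_zero.1 this).resolve_left ?_
      exact_mod_cast (hr0 n).ne'
    have h1 := (S - ((‖J‖⁻¹ : ℝ) : 𝕜) • J).le_opNorm u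
    rw [sub_apply, hSu, zero_sub, norm_neg, smul_apply,
      norm_smul, hinv, hJu, hv, mul_one] at h1
    have h2 : (1 / 2 : ℝ) ≤ ‖J‖⁻¹ := by
      rw [one_div]
      exact inv_anti₀ hJpos (by linarith [hr1 n])
    have h3 := mul_le_mul_of_nonneg_left hu (norm_nonneg (S - ((‖J‖⁻¹ : ℝ) : 𝕜) • J))
    linarith

end
end

section
/- Let 1 < p < ∞ and let μ be a positive measure such that the real Banach space L_p(μ) has dimension at least 2 (in particular this covers ℓ_p and ℓ_p^n for n ≥ 2). Then L_p(μ) is not a universal pointwise BPB range space: there exists a uniformly smooth Banach space X such that the pair (X, L_p(μ)) fails the pointwise Bishop–Phelps–Bollobás property. -/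
open scoped Topology ENNReal
open Filter Metric

noncomputable section

open MeasureTheory in
/-- For `1 < p < ∞`, the space `L_p(μ)` is strictly convex. -/
theorem strictConvexSpace_Lp {α : Type*} [MeasurableSpace α] (μ : Measure α)
    (p : ℝ≥0∞) [Fact (1 ≤ p)] (hp : 1 < p) (hp' : p ≠ ∞) :
    StrictConvexSpace ℝ (Lp ℝ p μ) := by
  have hp0 : p ≠ 0 := (zero_lt_one.trans hp).ne'
  have hq : 1 < p.toReal := by
    rw [← ENNReal.toReal_one]
    exact (ENNReal.toReal_lt_toReal ENNReal.one_ne_top hp').2 hp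
  have hq0 : 0 < p.toReal := zero_lt_one.trans hq
  have norm_rpow (f : Lp ℝ p μ) : ‖f‖ ^ p.toReal = ∫ x, ‖f x‖ ^ p.toReal ∂μ := by
    have h0 : 0 ≤ ∫ x, ‖f x‖ ^ p.toReal ∂μ := integral_nonneg fun x => by positivity
    rw [Lp.norm_def, (Lp.memLp f).eLpNorm_eq_integral_rpow_norm hp0 hp',
      ENNReal.toReal_ofReal (by positivity), ← Real.rpow_mul h0, inv_mul_cancel₀ hq0.ne',
      Real.rpow_one]
  have hint (f : Lp ℝ p μ) : Integrable (fun x => ‖f x‖ ^ p.toReal) μ :=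
    (Lp.memLp f).integrable_norm_rpow hp0 hp'
  have key (a b : ℝ) : ‖(2 : ℝ)⁻¹ * (a + b)‖ ^ p.toReal ≤
      2⁻¹ * (‖a‖ ^ p.toReal + ‖b‖ ^ p.toReal) ∧
      (‖(2 : ℝ)⁻¹ * (a + b)‖ ^ p.toReal = 2⁻¹ * (‖a‖ ^ p.toReal + ‖b‖ ^ p.toReal) → a = b) := by
    have hab : ‖(2 : ℝ)⁻¹ * (a + b)‖ ≤ 2⁻¹ * ‖a‖ + 2⁻¹ * ‖b‖ := by
      rw [norm_mul, ← mul_add]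
      norm_num
      exact abs_add_le a b
    have h1 : ‖(2 : ℝ)⁻¹ * (a + b)‖ ^ p.toReal ≤ (2⁻¹ * ‖a‖ + 2⁻¹ * ‖b‖) ^ p.toReal :=
      Real.rpow_le_rpow (norm_nonneg _) hab hq0.le
    have hconv := strictConvexOn_rpow hq
    have h2 : (2⁻¹ * ‖a‖ + 2⁻¹ * ‖b‖) ^ p.toReal ≤ 2⁻¹ * ‖a‖ ^ p.toReal + 2⁻¹ * ‖b‖ ^ p.toReal := by
      simpa using hconv.convexOn.2 (norm_nonneg a) (norm_nonneg b) (by norm_num : (0 : ℝ) ≤ 2⁻¹)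
        (by norm_num : (0 : ℝ) ≤ 2⁻¹) (by norm_num)
    refine ⟨by linarith, fun heq => ?_⟩
    have hnorm : ‖a‖ = ‖b‖ := by
      by_contra hne
      have h3 : (2⁻¹ * ‖a‖ + 2⁻¹ * ‖b‖) ^ p.toReal <
          2⁻¹ * ‖a‖ ^ p.toReal + 2⁻¹ * ‖b‖ ^ p.toReal := by
        simpa using hconv.2 (norm_nonneg a) (norm_nonneg b) hne
          (by norm_num : (0 : ℝ) < 2⁻¹) (by norm_num : (0 : ℝ) < 2⁻¹) (by norm_num)
      linarith
    rw [← hnorm] at heq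
    have h4 : ‖(2 : ℝ)⁻¹ * (a + b)‖ = ‖a‖ :=
      (Real.rpow_left_inj (norm_nonneg _) (norm_nonneg _) hq0.ne').1 (by linarith)
    refine eq_of_norm_eq_of_norm_add_eq hnorm ?_
    rw [norm_mul] at h4
    norm_num at h4 hnorm ⊢
    linarith
  refine StrictConvexSpace.of_norm_add_ne_two fun f g hf hg hfg hadd => hfg ?_
  have hmid : ‖(2 : ℝ)⁻¹ • (f + g)‖ = 1 := by
    rw [norm_smul, hadd]; norm_num
  have hcoe : ∀ᵐ x ∂μ, ((2 : ℝ)⁻¹ • (f + g) : Lp ℝ p μ) x = 2⁻¹ * (f x + g x) := by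
    filter_upwards [Lp.coeFn_smul (2 : ℝ)⁻¹ (f + g), Lp.coeFn_add f g] with x h1 h2
    rw [h1, Pi.smul_apply, h2, Pi.add_apply, smul_eq_mul]
  have hnn : 0 ≤ᵐ[μ] fun x => 2⁻¹ * (‖f x‖ ^ p.toReal + ‖g x‖ ^ p.toReal) -
      ‖((2 : ℝ)⁻¹ • (f + g) : Lp ℝ p μ) x‖ ^ p.toReal := by
    filter_upwards [hcoe] with x hx
    rw [hx]
    exact sub_nonneg.2 (key _ _).1
  have hfgint := ((hint f).add (hint g)).const_mul 2⁻¹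
  have hzero := (integral_eq_zero_iff_of_nonneg_ae hnn
    (hfgint.sub (hint ((2 : ℝ)⁻¹ • (f + g))))).1 (by
      have h := integral_sub hfgint (hint ((2 : ℝ)⁻¹ • (f + g)))
      simp only [Pi.add_apply] at h
      rw [h, integral_const_mul, integral_add (hint f) (hint g), ← norm_rpow, ← norm_rpow,
        ← norm_rpow, hf, hg, hmid, Real.one_rpow]
      norm_num)
  refine Lp.ext ?_
  filter_upwards [hzero, hcoe] with x h1 h2
  rw [h2] at h1
  exact (key _ _).2 (sub_eq_zero.1 h1).symm

/-- A normed space of dimension at least `2` contains a unit vector `y₁` and a nonzero vector `y₂`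
such that the coordinate map on their span is dominated by the Euclidean norm. -/
theorem exists_norm_smul_add_smul_sq_le {Y : Type*} [NormedAddCommGroup Y] [NormedSpace ℝ Y]
    (hdim : ∃ f g : Y, LinearIndependent ℝ ![f, g]) :
    ∃ y₁ y₂ : Y, ‖y₁‖ = 1 ∧ y₂ ≠ 0 ∧ ∀ a b : ℝ, ‖a • y₁ + b • y₂‖ ^ 2 ≤ a ^ 2 + b ^ 2 := by
  obtain ⟨f, g, hfg⟩ := hdim
  let A : ℂ →ₗ[ℝ] Y := Complex.reLm.smulRight f + Complex.imLm.smulRight g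
  have hA (z : ℂ) : A z = z.re • f + z.im • g := rfl
  have hinj (z : ℂ) (hz : A z = 0) : z = 0 := by
    obtain ⟨h1, h2⟩ := LinearIndependent.pair_iff.1 hfg _ _ hz
    exact Complex.ext h1 h2
  have hcont : Continuous A := A.continuous_of_finiteDimensional
  obtain ⟨u, hu, hmax⟩ := (isCompact_sphere (0 : ℂ) 1).exists_isMaxOn
    ⟨1, by simp⟩ hcont.norm.continuousOn
  have hu1 : ‖u‖ = 1 := by simpa using hu
  have hu0 : u ≠ 0 := by
    rintro rfl
    simp at hu1
  set M := ‖A u‖ with hM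
  have hMpos : 0 < M := norm_pos_iff.2 fun h => hu0 (hinj u h)
  have hbound (z : ℂ) : ‖A z‖ ≤ M * ‖z‖ := by
    rcases eq_or_ne z 0 with rfl | hz
    · simp
    · have hz' : 0 < ‖z‖ := norm_pos_iff.2 hz
      have h : ‖A ((‖z‖⁻¹ : ℝ) • z)‖ ≤ M :=
        hmax (by simp [hz'.ne'])
      rw [map_smul, norm_smul, norm_inv, norm_norm, inv_mul_le_iff₀ hz'] at h
      linarith
  refine ⟨M⁻¹ • A u, M⁻¹ • A (Complex.I * u), ?_, ?_, fun a b => ?_⟩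
  · rw [norm_smul, norm_inv, Real.norm_of_nonneg hMpos.le, ← hM, inv_mul_cancel₀ hMpos.ne']
  · refine smul_ne_zero (inv_ne_zero hMpos.ne') fun h => ?_
    simpa [hu0] using hinj _ h
  · have h1 : a • M⁻¹ • A u + b • M⁻¹ • A (Complex.I * u) = M⁻¹ • A ((a + b * Complex.I) * u) := by
      rw [smul_comm a, smul_comm b, ← smul_add, ← map_smul, ← map_smul, ← map_add]
      congr 2
      simp only [Complex.real_smul]
      ring
    have h2 : ‖(a + b * Complex.I) * u‖ ^ 2 = a ^ 2 + b ^ 2 := by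
      rw [norm_mul, hu1, mul_one, Complex.sq_norm, Complex.normSq_add_mul_I]
    rw [h1, ← h2]
    gcongr
    rw [norm_smul, norm_inv, Real.norm_of_nonneg hMpos.le, inv_mul_le_iff₀ hMpos]
    exact hbound _

section InfConvolution

variable {Z H : Type*} [NormedAddCommGroup Z] [NormedSpace ℝ Z] [NormedAddCommGroup H]
  [InnerProductSpace ℝ H]

/-- The map `(z, h) ↦ D z + h` on the Hilbertian sum of `Z` and `H`. -/
def sumMap (D : Z →L[ℝ] H) : WithLp 2 (Z × H) →L[ℝ] H :=
  D ∘L WithLp.fstL 2 ℝ Z H + WithLp.sndL 2 ℝ Z H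

theorem sumMap_apply (D : Z →L[ℝ] H) (v : WithLp 2 (Z × H)) :
    sumMap D v = D v.fst + v.snd := rfl

instance isClosed_ker_sumMap (D : Z →L[ℝ] H) :
    IsClosed ((sumMap D).ker : Set (WithLp 2 (Z × H))) :=
  (sumMap D).isClosed_ker

/-- The space `H` renormed by `N(x)² = inf_z (‖z‖² + ‖x - D z‖²)`, realised as a quotient of the
Hilbertian sum of `Z` and `H`. -/
abbrev InfConv (D : Z →L[ℝ] H) : Type _ := WithLp 2 (Z × H) ⧸ (sumMap D).ker

/-- The canonical map from `H` to its renorming. -/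
def InfConv.of (D : Z →L[ℝ] H) (x : H) : InfConv D :=
  Submodule.Quotient.mk (WithLp.toLp 2 (0, x))

namespace InfConv

variable (D : Z →L[ℝ] H)

theorem mk_eq_of (v : WithLp 2 (Z × H)) :
    (Submodule.Quotient.mk v : InfConv D) = of D (sumMap D v) := by
  refine (Submodule.Quotient.eq _).2 ?_
  simp [sumMap_apply]

theorem of_add (x y : H) : of D (x + y) = of D x + of D y := by
  rw [of, of, of, ← Submodule.Quotient.mk_add, ← WithLp.toLp_add]
  simp

theorem of_neg (x : H) : of D (-x) = -of D x := by
  rw [of, of, ← Submodule.Quotient.mk_neg, ← WithLp.toLp_neg]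
  simp

theorem of_smul (c : ℝ) (x : H) : of D (c • x) = c • of D x := by
  rw [of, of, ← Submodule.Quotient.mk_smul, ← WithLp.toLp_smul]
  simp

theorem norm_of_sq_le (z : Z) (h : H) : ‖of D (D z + h)‖ ^ 2 ≤ ‖z‖ ^ 2 + ‖h‖ ^ 2 := by
  have h1 := mk_eq_of D (WithLp.toLp 2 (z, h))
  rw [sumMap_apply] at h1
  have h2 := Submodule.Quotient.norm_mk_le (sumMap D).ker (WithLp.toLp 2 (z, h))
  change Submodule.Quotient.mk (WithLp.toLp 2 (z, h)) = of D (D z + h) at h1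
  have h3 : ‖WithLp.toLp 2 (z, h)‖ ^ 2 = ‖z‖ ^ 2 + ‖h‖ ^ 2 := WithLp.prod_norm_sq_eq_of_L2 _
  rw [← h3, ← h1]
  gcongr

theorem exists_eq_of (x : InfConv D) {s : ℝ} (hs : ‖x‖ < s) :
    ∃ z h, x = of D (D z + h) ∧ ‖z‖ ^ 2 + ‖h‖ ^ 2 ≤ s ^ 2 := by
  obtain ⟨v, rfl, hv⟩ := Submodule.Quotient.norm_mk_lt x (sub_pos.2 hs)
  refine ⟨v.fst, v.snd, mk_eq_of D v, ?_⟩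
  rw [← WithLp.prod_norm_sq_eq_of_L2]
  gcongr
  linarith

theorem exists_of_eq (x : InfConv D) {s : ℝ} (hs : ‖x‖ < s) :
    ∃ g, x = of D g ∧ ‖g‖ ≤ (‖D‖ + 1) * s := by
  obtain ⟨z, h, rfl, hzh⟩ := exists_eq_of D x hs
  have hs0 : 0 ≤ s := (norm_nonneg _).trans hs.le
  refine ⟨_, rfl, ?_⟩
  have hz : ‖z‖ ≤ s := (sq_le_sq₀ (norm_nonneg _) hs0).1 (by nlinarith [sq_nonneg ‖h‖])
  have hh : ‖h‖ ≤ s := (sq_le_sq₀ (norm_nonneg _) hs0).1 (by nlinarith [sq_nonneg ‖z‖])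
  calc ‖D z + h‖ ≤ ‖D‖ * ‖z‖ + ‖h‖ := (norm_add_le _ _).trans (by gcongr; exact D.le_opNorm z)
    _ ≤ ‖D‖ * s + s := by gcongr
    _ = _ := by ring

theorem norm_add_sq_add_norm_sub_sq_le (x : InfConv D) (g : H) {s : ℝ} (hs : ‖x‖ < s) :
    ‖x + of D g‖ ^ 2 + ‖x - of D g‖ ^ 2 ≤ 2 * s ^ 2 + 2 * ‖g‖ ^ 2 := by
  obtain ⟨z, h, rfl, hzh⟩ := exists_eq_of D x hs
  have h1 := norm_of_sq_le D z (h + g)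
  have h2 := norm_of_sq_le D z (h - g)
  rw [← add_assoc, of_add D (D z + h)] at h1
  rw [sub_eq_add_neg, ← add_assoc, of_add D (D z + h), of_neg, ← sub_eq_add_neg,
    ← sub_eq_add_neg] at h2
  nlinarith [parallelogram_law_with_norm ℝ h g]

theorem uniformlySmooth : UniformlySmooth (InfConv D) := by
  set C := 1 + (2 * (‖D‖ + 1)) ^ 2 with hC
  have hC0 : 0 ≤ C := by positivity
  have hle (t : ℝ) (ht : 0 < t) : modulusOfSmoothness (InfConv D) t ≤ C / 2 * t ^ 2 := by
    refine Real.sSup_le ?_ (by positivity)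
    rintro r ⟨x, y, hx, hy, rfl⟩
    obtain ⟨g, rfl, hg⟩ := exists_of_eq D y (s := 2 * t) (by linarith)
    have hs : ‖x‖ < √(1 + t ^ 2) := by
      rw [hx]
      exact Real.lt_sqrt_of_sq_lt (by nlinarith)
    have h := norm_add_sq_add_norm_sub_sq_le D x g hs
    rw [Real.sq_sqrt (by positivity)] at h
    have hg2 : ‖g‖ ^ 2 ≤ ((‖D‖ + 1) * (2 * t)) ^ 2 := by gcongr
    nlinarith [sq_nonneg (‖x + of D g‖ - 1), sq_nonneg (‖x - of D g‖ - 1)]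
  have hnn (t : ℝ) : 0 ≤ modulusOfSmoothness (InfConv D) t := by
    refine Real.sSup_nonneg ?_
    rintro r ⟨x, y, hx, -, rfl⟩
    have h := norm_add_le (x + y) (x - y)
    rw [add_add_sub_cancel, ← two_smul ℝ x, norm_smul, hx] at h
    norm_num at h
    linarith
  refine squeeze_zero' (g := fun t => C / 2 * t) ?_ ?_ ?_
  · filter_upwards [self_mem_nhdsWithin] with t ht
    exact div_nonneg (hnn t) (le_of_lt ht)
  · filter_upwards [self_mem_nhdsWithin] with t (ht : 0 < t)
    rw [div_le_iff₀ ht]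
    calc _ ≤ _ := hle t ht
      _ = _ := by ring
  · have : Tendsto (fun t : ℝ => C / 2 * t) (𝓝 0) (𝓝 (C / 2 * 0)) :=
      tendsto_id.const_mul _
    rw [mul_zero] at this
    exact this.mono_left nhdsWithin_le_nhds

/-- The operator on the renorming induced by an operator on `H`. -/
def lift {Y : Type*} [NormedAddCommGroup Y] [NormedSpace ℝ Y] (B : H →L[ℝ] Y) :
    InfConv D →L[ℝ] Y :=
  (sumMap D).ker.liftQL (B ∘L sumMap D) fun v hv => by
    have hv' : sumMap D v = 0 := hv
    simp [hv']

theorem lift_of {Y : Type*} [NormedAddCommGroup Y] [NormedSpace ℝ Y] (B : H →L[ℝ] Y) (x : H) :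
    lift D B (of D x) = B x := by
  change B (sumMap D (WithLp.toLp 2 (0, x))) = B x
  simp [sumMap_apply]

theorem norm_lift_le {Y : Type*} [NormedAddCommGroup Y] [NormedSpace ℝ Y] (B : H →L[ℝ] Y) {C : ℝ}
    (hC : 0 ≤ C) (h : ∀ z h, ‖B (D z + h)‖ ≤ C * √(‖z‖ ^ 2 + ‖h‖ ^ 2)) : ‖lift D B‖ ≤ C := by
  refine ContinuousLinearMap.opNorm_le_bound _ hC fun x => ?_
  have key (s : ℝ) (hs : ‖x‖ < s) : ‖lift D B x‖ ≤ C * s := by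
    obtain ⟨z, g, rfl, hzg⟩ := exists_eq_of D x hs
    rw [lift_of]
    refine (h z g).trans ?_
    gcongr
    exact Real.sqrt_le_iff.2 ⟨(norm_nonneg _).trans hs.le, hzg⟩
  have hlim : Tendsto (fun s => C * s) (𝓝[>] ‖x‖) (𝓝 (C * ‖x‖)) :=
    (tendsto_id.const_mul C).mono_left nhdsWithin_le_nhds
  exact ge_of_tendsto hlim (by filter_upwards [self_mem_nhdsWithin] with s hs using key s hs)

end InfConv

end InfConvolution

/-- Multiplication by `1 / (n + 1)` from `ℓ^∞` to `ℓ²`. -/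
def harmonicDiag : lp (fun _ : ℕ => ℝ) ∞ →L[ℝ] lp (fun _ : ℕ => ℝ) 2 :=
  have hδ : Memℓp (fun n : ℕ => ((n : ℝ) + 1)⁻¹) 2 := by
    refine memℓp_gen (.congr ((summable_nat_add_iff 1).2
      (Real.summable_one_div_nat_pow.2 one_lt_two)) fun n => ?_)
    rw [Real.norm_of_nonneg (by positivity)]
    simp
  have hle (w : lp (fun _ : ℕ => ℝ) ∞) (n : ℕ) :
      ‖w n * ((n : ℝ) + 1)⁻¹‖ ≤ ‖‖w‖ * ((n : ℝ) + 1)⁻¹‖ := by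
    rw [norm_mul, norm_mul, norm_norm]
    gcongr
    exact lp.norm_apply_le_norm ENNReal.top_ne_zero w n
  LinearMap.mkContinuous
    { toFun := fun w => ⟨fun n => w n * ((n : ℝ) + 1)⁻¹,
        (hδ.const_mul ‖w‖).mono' (hle w)⟩
      map_add' := fun v w => by
        ext n
        exact add_mul _ _ _
      map_smul' := fun c w => by
        ext n
        exact mul_assoc _ _ _ }
    ‖(⟨_, hδ⟩ : lp (fun _ : ℕ => ℝ) 2)‖ fun w => by
      rw [mul_comm, ← norm_norm w, ← norm_smul]
      exact lp.norm_mono two_ne_zero (hle w)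

theorem harmonicDiag_apply (w : lp (fun _ : ℕ => ℝ) ∞) (n : ℕ) :
    harmonicDiag w n = w n * ((n : ℝ) + 1)⁻¹ := rfl

theorem norm_of_single_add_single_le {n : ℕ} (hn : n ≠ 0) {s : ℝ} (hs : |s| ≤ √2 / 2) :
    ‖InfConv.of harmonicDiag (lp.single 2 0 √2 + lp.single 2 n (s * ((n : ℝ) + 1)⁻¹))‖ ≤ 1 := by
  set z : lp (fun _ : ℕ => ℝ) ∞ := lp.single ∞ 0 (√2 / 2) + lp.single ∞ n s with hz
  set h : lp (fun _ : ℕ => ℝ) 2 := lp.single 2 0 (√2 / 2) with hh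
  have hsum : lp.single 2 0 √2 + lp.single 2 n (s * ((n : ℝ) + 1)⁻¹) = harmonicDiag z + h := by
    ext k
    rw [lp.coeFn_add, lp.coeFn_add, Pi.add_apply, Pi.add_apply, harmonicDiag_apply, hz, hh,
      lp.coeFn_add, Pi.add_apply]
    simp only [lp.coeFn_single, Pi.single_apply]
    rcases eq_or_ne k 0 with rfl | hk
    · simp [hn.symm]
    · rcases eq_or_ne k n with rfl | hkn
      · simp [hk]
      · simp [hk, hkn]
  have hznorm : ‖z‖ ≤ √2 / 2 := by
    refine lp.norm_le_of_forall_le (by positivity) fun k => ?_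
    rw [hz, lp.coeFn_add, Pi.add_apply]
    simp only [lp.coeFn_single, Pi.single_apply]
    rcases eq_or_ne k 0 with rfl | hk
    · simp [hn.symm, abs_of_nonneg]
    · rcases eq_or_ne k n with rfl | hkn
      · simpa [hk] using hs
      · simp only [hk, hkn, if_false, add_zero, norm_zero]
        positivity
  have hhnorm : ‖h‖ = √2 / 2 := by
    rw [hh, lp.norm_single two_pos, Real.norm_of_nonneg (by positivity)]
  have hle := InfConv.norm_of_sq_le harmonicDiag z h
  rw [hsum]
  have h2 : √2 ^ 2 = 2 := Real.sq_sqrt (by norm_num)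
  have h3 : ‖z‖ ^ 2 ≤ (√2 / 2) ^ 2 := by gcongr
  rw [hhnorm] at hle
  rw [← sq_le_one_iff₀ (norm_nonneg _)]
  linarith [show (√2 / 2) ^ 2 = 1 / 2 by rw [div_pow, h2]; norm_num]

theorem norm_lift_eval_add_eval_le {Y : Type*} [NormedAddCommGroup Y] [NormedSpace ℝ Y]
    {y₁ y₂ : Y} (hy : ∀ a b : ℝ, ‖a • y₁ + b • y₂‖ ^ 2 ≤ a ^ 2 + b ^ 2) {n : ℕ} (hn : n ≠ 0) :
    ‖InfConv.lift harmonicDiag ((lp.evalCLM ℝ (fun _ : ℕ => ℝ) 2 0).smulRight y₁ +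
      (lp.evalCLM ℝ (fun _ : ℕ => ℝ) 2 n).smulRight y₂)‖ ≤ √2 + ((n : ℝ) + 1)⁻¹ := by
  refine InfConv.norm_lift_le _ _ (by positivity) fun z h => ?_
  set R := √(‖z‖ ^ 2 + ‖h‖ ^ 2) with hR
  have hR2 : R ^ 2 = ‖z‖ ^ 2 + ‖h‖ ^ 2 := Real.sq_sqrt (by positivity)
  have hR0 : 0 ≤ R := Real.sqrt_nonneg _
  have hy₂ : ‖y₂‖ ≤ 1 := by
    have h1 := hy 0 1
    simp only [zero_smul, one_smul, zero_add] at h1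
    rw [← sq_le_one_iff₀ (norm_nonneg _)]
    linarith
  have hz (k : ℕ) : |z k| ≤ ‖z‖ := lp.norm_apply_le_norm ENNReal.top_ne_zero z k
  have hzR : ‖z‖ ≤ R := Real.le_sqrt_of_sq_le (by nlinarith [sq_nonneg ‖h‖])
  have hhsq : h 0 ^ 2 + h n ^ 2 ≤ ‖h‖ ^ 2 := by
    simpa [Finset.sum_pair hn.symm] using
      lp.sum_rpow_le_norm_rpow (p := 2) (by norm_num) h {0, n}
  have hz0 : z 0 ^ 2 ≤ ‖z‖ ^ 2 := sq_le_sq' (abs_le.1 (hz 0)).1 (abs_le.1 (hz 0)).2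
  have hsplit : ((lp.evalCLM ℝ (fun _ : ℕ => ℝ) 2 0).smulRight y₁ +
      (lp.evalCLM ℝ (fun _ : ℕ => ℝ) 2 n).smulRight y₂) (harmonicDiag z + h) =
      ((z 0 + h 0) • y₁ + h n • y₂) + (z n * ((n : ℝ) + 1)⁻¹) • y₂ := by
    change (harmonicDiag z 0 + h 0) • y₁ + (harmonicDiag z n + h n) • y₂ = _
    rw [harmonicDiag_apply, harmonicDiag_apply, add_smul (z n * _)]
    simp only [Nat.cast_zero, zero_add, inv_one, mul_one]
    abel
  rw [hsplit, add_mul]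
  refine (norm_add_le _ _).trans (add_le_add ?_ ?_)
  · rw [← sq_le_sq₀ (norm_nonneg _) (by positivity), mul_pow, Real.sq_sqrt (by norm_num), hR2]
    nlinarith [hy (z 0 + h 0) (h n), sq_nonneg (z 0 - h 0), sq_nonneg (h n)]
  · rw [norm_smul, norm_mul, Real.norm_of_nonneg (by positivity : (0 : ℝ) ≤ ((n : ℝ) + 1)⁻¹),
      mul_comm ‖z n‖]
    calc ((n : ℝ) + 1)⁻¹ * ‖z n‖ * ‖y₂‖ ≤ ((n : ℝ) + 1)⁻¹ * ‖z n‖ * 1 := by gcongr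
      _ ≤ ((n : ℝ) + 1)⁻¹ * R := by
        rw [mul_one]
        gcongr
        exact (hz n).trans hzR

theorem norm_of_single_zero : ‖InfConv.of harmonicDiag (lp.single 2 0 √2)‖ = 1 := by
  refine le_antisymm ?_ (le_of_mul_le_mul_left ?_ (show 0 < √2 by positivity))
  · simpa using norm_of_single_add_single_le one_ne_zero (s := 0) (by rw [abs_zero]; positivity)
  · set T := InfConv.lift harmonicDiag (lp.evalCLM ℝ (fun _ : ℕ => ℝ) 2 0)
    have hT : ‖T‖ ≤ √2 := by
      refine InfConv.norm_lift_le _ _ (by positivity) fun z h => ?_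
      change ‖harmonicDiag z 0 + h 0‖ ≤ _
      have hz : ‖z 0‖ ≤ ‖z‖ := lp.norm_apply_le_norm ENNReal.top_ne_zero z 0
      have hh : ‖h 0‖ ≤ ‖h‖ := lp.norm_apply_le_norm two_ne_zero h 0
      rw [← Real.sqrt_mul zero_le_two, harmonicDiag_apply]
      refine Real.le_sqrt_of_sq_le ?_
      have h1 : ‖z 0 * (((0 : ℕ) : ℝ) + 1)⁻¹ + h 0‖ ≤ ‖z‖ + ‖h‖ := by
        refine (norm_add_le _ _).trans (add_le_add ?_ hh)
        simpa using hz
      calc _ ≤ (‖z‖ + ‖h‖) ^ 2 := by gcongr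
        _ ≤ _ := by nlinarith [sq_nonneg (‖z‖ - ‖h‖)]
    have hTx : T (InfConv.of harmonicDiag (lp.single 2 0 √2)) = √2 := by
      rw [InfConv.lift_of]
      change lp.single (E := fun _ : ℕ => ℝ) 2 0 √2 0 = √2
      exact lp.single_apply_self (E := fun _ : ℕ => ℝ) 2 0 √2
    have h := T.le_of_opNorm_le hT (InfConv.of harmonicDiag (lp.single 2 0 √2))
    rw [hTx, Real.norm_of_nonneg (by positivity)] at h
    linarith

theorem ContinuousLinearMap.apply_eq_zero_of_norm_add_le_of_norm_sub_le {X Y : Type*}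
    [NormedAddCommGroup X] [NormedSpace ℝ X] [NormedAddCommGroup Y] [NormedSpace ℝ Y]
    [StrictConvexSpace ℝ Y] (S : X →L[ℝ] Y) (hS : ‖S‖ = 1) {x v : X} (hx : ‖S x‖ = 1)
    (hadd : ‖x + v‖ ≤ 1) (hsub : ‖x - v‖ ≤ 1) : S v = 0 := by
  have h1 := S.le_of_opNorm_le hS.le (x + v)
  have h2 := S.le_of_opNorm_le hS.le (x - v)
  rw [map_add] at h1
  rw [map_sub] at h2
  have h3 : ‖(S x + S v) + (S x - S v)‖ = 2 := by
    rw [add_add_sub_cancel, ← two_smul ℝ, norm_smul, hx]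
    norm_num
  have h4 := norm_add_le (S x + S v) (S x - S v)
  have h5 := eq_of_norm_eq_of_norm_add_eq (x := S x + S v) (y := S x - S v)
    (by linarith) (by linarith)
  have h6 := sub_eq_zero.2 h5
  rw [add_sub_sub_cancel, ← two_smul ℝ] at h6
  exact (smul_eq_zero.1 h6).resolve_left two_ne_zero

/-- If the unit sphere of `X` contains segments centred at `x₀`, and there are operators almost
attaining their norm at `x₀` that are uniformly large on the directions of these segments, then
`(X, Y)` fails the pointwise BPB property for strictly convex `Y`. -/
theorem not_ptwiseBPB_of_flat_directions {X Y : Type*} [NormedAddCommGroup X] [NormedSpace ℝ X]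
    [NormedAddCommGroup Y] [NormedSpace ℝ Y] [StrictConvexSpace ℝ Y] {x₀ : X} (hx₀ : ‖x₀‖ = 1)
    {M c : ℝ} (hM : 1 ≤ M) (hc : 0 < c)
    (h : ∀ δ : ℝ, 0 < δ → ∃ (T : X →L[ℝ] Y) (e : X) (t : ℝ), ‖T‖ ≤ M + δ ∧ ‖T x₀‖ = M ∧
      c ≤ ‖T e‖ ∧ ‖e‖ ≤ 1 ∧ 0 < t ∧ ‖x₀ + t • e‖ ≤ 1 ∧ ‖x₀ - t • e‖ ≤ 1) :
    ¬ PtwiseBPB ℝ X Y := by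
  intro hBPB
  obtain ⟨η, hη, hmain⟩ := hBPB (c / (M + 1)) (by positivity)
  obtain ⟨T, e, t, hT, hTx₀, hTe, he, ht, hadd, hsub⟩ := h (min 1 (η / 2)) (by positivity)
  have hδ1 : min 1 (η / 2) ≤ 1 := min_le_left _ _
  have hδη : min 1 (η / 2) ≤ η / 2 := min_le_right _ _
  have hMT : M ≤ ‖T‖ := by simpa [hx₀, hTx₀] using T.le_opNorm x₀
  have hTpos : 0 < ‖T‖ := by linarith
  have hnorm (y : X) : ‖(‖T‖⁻¹ • T) y‖ = ‖T y‖ / ‖T‖ := by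
    rw [smul_apply, norm_smul, norm_inv, Real.norm_of_nonneg hTpos.le, ← div_eq_inv_mul]
  obtain ⟨S, hS, hSx₀, hST⟩ := hmain (‖T‖⁻¹ • T) x₀
    (by rw [norm_smul, norm_inv, Real.norm_of_nonneg hTpos.le, inv_mul_cancel₀ hTpos.ne']) hx₀
    (by
      rw [hnorm, hTx₀, lt_div_iff₀ hTpos]
      nlinarith)
  have hSe : S e = 0 := by
    have h1 := S.apply_eq_zero_of_norm_add_le_of_norm_sub_le hS hSx₀ hadd hsub
    rw [map_smul] at h1
    exact (smul_eq_zero.1 h1).resolve_left ht.ne'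
  have h1 := (S - ‖T‖⁻¹ • T).le_opNorm e
  rw [sub_apply, hSe, zero_sub, norm_neg, hnorm] at h1
  have h2 : ‖T e‖ / ‖T‖ < c / (M + 1) :=
    (h1.trans (mul_le_of_le_one_right (norm_nonneg _) he)).trans_lt hST
  refine absurd h2 (not_lt.2 ?_)
  gcongr
  linarith

/-- A strictly convex space of dimension at least `2` fails the pointwise BPB property with the
renorming of `ℓ²` along `harmonicDiag` as domain. -/
theorem not_ptwiseBPB_infConv {Y : Type*} [NormedAddCommGroup Y] [NormedSpace ℝ Y]
    [StrictConvexSpace ℝ Y] (hdim : ∃ f g : Y, LinearIndependent ℝ ![f, g]) :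
    ¬ PtwiseBPB ℝ (InfConv harmonicDiag) Y := by
  obtain ⟨y₁, y₂, hy₁, hy₂, hy⟩ := exists_norm_smul_add_smul_sq_le hdim
  refine not_ptwiseBPB_of_flat_directions norm_of_single_zero (M := √2)
    (Real.one_le_sqrt.2 one_le_two) (norm_pos_iff.2 hy₂) fun δ hδ => ?_
  obtain ⟨m, hm⟩ := exists_nat_one_div_lt hδ
  have hn : m + 1 ≠ 0 := m.succ_ne_zero
  set n := m + 1 with hnm
  have hδn : ((n : ℝ) + 1)⁻¹ ≤ δ := by
    refine le_trans ?_ hm.le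
    rw [one_div, hnm]
    gcongr
    linarith
  have hflat (s : ℝ) (hs : |s| ≤ √2 / 2) : ‖InfConv.of harmonicDiag (lp.single 2 0 √2) +
      (s * ((n : ℝ) + 1)⁻¹) • InfConv.of harmonicDiag (lp.single 2 n 1)‖ ≤ 1 := by
    rw [← InfConv.of_smul, ← InfConv.of_add, ← lp.single_smul, smul_eq_mul, mul_one]
    exact norm_of_single_add_single_le hn hs
  refine ⟨InfConv.lift harmonicDiag ((lp.evalCLM ℝ (fun _ : ℕ => ℝ) 2 0).smulRight y₁ +
      (lp.evalCLM ℝ (fun _ : ℕ => ℝ) 2 n).smulRight y₂), InfConv.of harmonicDiag (lp.single 2 n 1),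
    √2 / 2 * ((n : ℝ) + 1)⁻¹, ?_, ?_, ?_, ?_, by positivity, ?_, ?_⟩
  · exact (norm_lift_eval_add_eval_le hy hn).trans (by linarith)
  · rw [InfConv.lift_of]
    change ‖(lp.single (E := fun _ : ℕ => ℝ) 2 0 √2) 0 • y₁ +
      (lp.single (E := fun _ : ℕ => ℝ) 2 0 √2) n • y₂‖ = √2
    simp [hn, norm_smul, hy₁]
  · rw [InfConv.lift_of]
    change ‖y₂‖ ≤ ‖(lp.single (E := fun _ : ℕ => ℝ) 2 n 1) 0 • y₁ +
      (lp.single (E := fun _ : ℕ => ℝ) 2 n 1) n • y₂‖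
    simp [hn.symm]
  · have h := InfConv.norm_of_sq_le harmonicDiag 0 (lp.single 2 n 1)
    rw [map_zero, zero_add, lp.norm_single two_pos, norm_zero, norm_one] at h
    rw [← sq_le_one_iff₀ (norm_nonneg _)]
    linarith
  · exact hflat _ (abs_of_nonneg (by positivity)).le
  · have h := hflat (-(√2 / 2)) (by rw [abs_neg, abs_of_nonneg (by positivity)])
    rwa [neg_mul, neg_smul, ← sub_eq_add_neg] at h

open MeasureTheory in
/-- For `1 < p < ∞`, a real space `L_p(μ)` of dimension at least `2` is not
a universal pointwise BPB range space. -/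
theorem Lp_not_universal_range {α : Type*} [MeasurableSpace α] (μ : Measure α)
    (p : ℝ≥0∞) [Fact (1 ≤ p)] (hp : 1 < p) (hp' : p ≠ ∞)
    (hdim : ∃ f g : Lp ℝ p μ, LinearIndependent ℝ ![f, g]) :
    ∃ (X : Type) (_ : NormedAddCommGroup X) (_ : NormedSpace ℝ X) (_ : CompleteSpace X),
      UniformlySmooth X ∧ ¬ PtwiseBPB ℝ X (Lp ℝ p μ) := by
  have := strictConvexSpace_Lp μ p hp hp'
  exact ⟨InfConv harmonicDiag, inferInstance, inferInstance, inferInstance,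
    InfConv.uniformlySmooth harmonicDiag, not_ptwiseBPB_infConv hdim⟩

end
end
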